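/- Let G be a graph with maximum degree 7 on n vertices whose edge set can be partitioned into the edge set of a subgraph H of maximum degree 6 and a matching M. Then G admits a 2-bend RAC drawing of O(n²) area (in fact with all vertices and bend points on integer grid points inside a square of side 8n). -/

import Mathlib

open scoped Classical

noncomputable section

/-- A point of the Euclidean plane. -/
abbrev Pt : Type := ℝ × ℝ

/-- The segments with endpoints `a, b` and `c, d` are orthogonal:
their direction vectors have zero inner product. -/
def SegOrth (a b c d : Pt) : Prop :=
  (b.1 - a.1) * (d.1 - c.1) + (b.2 - a.2) * (d.2 - c.2) = 0

/-- The degree of a vertex in a simple graph. -/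
def vdeg {V : Type*} (G : SimpleGraph V) (v : V) : ℕ := (G.neighborSet v).ncard

/-- `M` is a matching in `G`: a set of edges of `G` that are pairwise non-adjacent. -/
def IsMatchingOn {V : Type*} (G : SimpleGraph V) (M : Set (Sym2 V)) : Prop :=
  M ⊆ G.edgeSet ∧ ∀ e ∈ M, ∀ f ∈ M, e ≠ f → ∀ v : V, v ∈ e → v ∉ f

/-- `G` is `k`-edge-colorable: its edge set is partitioned into `k` matchings. -/
def EdgeColorable {V : Type*} (G : SimpleGraph V) (k : ℕ) : Prop :=
  ∃ M : Fin k → Set (Sym2 V),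
    (∀ i, IsMatchingOn G (M i)) ∧
    (∀ i j, i ≠ j → Disjoint (M i) (M j)) ∧
    (⋃ i, M i) = G.edgeSet

/-- `p` is a straight-line RAC drawing of `G`: vertices are at pairwise distinct points,
each edge is the closed segment between its endpoints, no edge passes through another
vertex, edges sharing an endpoint meet only there, and any two edges with no common
endpoint that intersect do so orthogonally. -/
structure IsRACDrawing {V : Type*} (G : SimpleGraph V) (p : V → Pt) : Prop where
  inj : Function.Injective p
  vertex_off : ∀ u v w : V, G.Adj u v → w ≠ u → w ≠ v →
    p w ∉ segment ℝ (p u) (p v)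
  shared : ∀ u v w : V, G.Adj u v → G.Adj u w → v ≠ w →
    segment ℝ (p u) (p v) ∩ segment ℝ (p u) (p w) ⊆ {p u}
  rac : ∀ u v u' v' : V, G.Adj u v → G.Adj u' v' →
    u ≠ u' → u ≠ v' → v ≠ u' → v ≠ v' →
    (segment ℝ (p u) (p v) ∩ segment ℝ (p u') (p v')).Nonempty →
    SegOrth (p u) (p v) (p u') (p v')

/-- All points of `P` are integer grid points lying in an axis-aligned square
of side length `side`. -/
def InGridSquare (side : ℝ) (P : Set Pt) : Prop :=
  (∀ q ∈ P, ∃ a b : ℤ, q = ((a : ℝ), (b : ℝ))) ∧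
  ∃ x0 y0 : ℝ, ∀ q ∈ P, x0 ≤ q.1 ∧ q.1 ≤ x0 + side ∧ y0 ≤ q.2 ∧ q.2 ≤ y0 + side

/-- The list of consecutive segments (as pairs of endpoints) of a polyline given
by its list of points. -/
def polySegs (l : List Pt) : List (Pt × Pt) := l.zip l.tail

/-- The set of plane points covered by a polyline given by its list of points. -/
def polySet (l : List Pt) : Set Pt := ⋃ s ∈ polySegs l, segment ℝ s.1 s.2

/-- `p, poly` is a `k`-bend RAC drawing of `G`: each edge `e` is drawn as the polyline
through the list of points `poly e` (at most `k + 1` segments, i.e. at most `k + 2`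
points) joining the two endpoints of `e`; no edge passes through another vertex; edges
sharing an endpoint meet only at that endpoint; any two distinct edges intersect in
finitely many points; and wherever segments of two distinct edges meet (other than at
the point of a common endvertex) the two segments are orthogonal. -/
structure IsBendRACDrawing {V : Type*} (k : ℕ) (G : SimpleGraph V)
    (p : V → Pt) (poly : Sym2 V → List Pt) : Prop where
  inj : Function.Injective p
  ends : ∀ e ∈ G.edgeSet, ∃ u v : V, e = s(u, v) ∧
    (poly e).head? = some (p u) ∧ (poly e).getLast? = some (p v)
  nsegs : ∀ e ∈ G.edgeSet, 2 ≤ (poly e).length ∧ (poly e).length ≤ k + 2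
  vertex_off : ∀ e ∈ G.edgeSet, ∀ w : V, w ∉ e → p w ∉ polySet (poly e)
  shared : ∀ e ∈ G.edgeSet, ∀ e' ∈ G.edgeSet, e ≠ e' → ∀ w : V, w ∈ e → w ∈ e' →
    polySet (poly e) ∩ polySet (poly e') ⊆ {p w}
  fin_inter : ∀ e ∈ G.edgeSet, ∀ e' ∈ G.edgeSet, e ≠ e' →
    (polySet (poly e) ∩ polySet (poly e')).Finite
  rac : ∀ e ∈ G.edgeSet, ∀ e' ∈ G.edgeSet, e ≠ e' →
    ∀ s ∈ polySegs (poly e), ∀ s' ∈ polySegs (poly e'),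
    ∀ x : Pt, x ∈ segment ℝ s.1 s.2 → x ∈ segment ℝ s'.1 s'.2 →
    (∀ w : V, w ∈ e → w ∈ e' → x ≠ p w) →
    SegOrth s.1 s.2 s'.1 s'.2

/-- All vertex points and bend points of a polyline drawing. -/
def drawingPoints {V : Type*} (G : SimpleGraph V) (p : V → Pt)
    (poly : Sym2 V → List Pt) : Set Pt :=
  Set.range p ∪ {q | ∃ e ∈ G.edgeSet, q ∈ poly e}

/-- `F` is (the edge set of) a 2-factor of `G`: a spanning subgraph in which every
vertex has degree exactly 2. -/
def Is2Factor {V : Type*} (G : SimpleGraph V) (F : Set (Sym2 V)) : Prop :=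
  F ⊆ G.edgeSet ∧ ∀ v : V, {e ∈ F | v ∈ e}.ncard = 2

/-- The connected components of the (2-regular) spanning subgraph with edge set `F`
that are odd cycles, i.e. have an odd number of vertices. -/
def oddComps {V : Type*} (F : Set (Sym2 V)) :
    Set ((SimpleGraph.fromEdgeSet F).ConnectedComponent) :=
  {C | Odd C.supp.ncard}

/-- `G` has oddness `k`: the minimum over all 2-factors of the number of odd-cycle
components equals `k` (in particular a 2-factor exists). -/
def HasOddness {V : Type*} (G : SimpleGraph V) (k : ℕ) : Prop :=
  (∃ F, Is2Factor G F ∧ (oddComps F).ncard = k) ∧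
  (∀ F, Is2Factor G F → k ≤ (oddComps F).ncard)

/-- `G` has no cut-edge. -/
def Bridgeless {V : Type*} (G : SimpleGraph V) : Prop := ∀ e, ¬ G.IsBridge e

/-! ### Part I: a linear order of the vertices with a good port assignment -/

/-- Pairs `(u, v)` of adjacent vertices with `u` before `v` that are not consecutive. -/
def NF {V : Type} [Fintype V] (G : SimpleGraph V) (f : V → ℚ) : Finset (V × V) :=
  Finset.univ.filter fun e => G.Adj e.1 e.2 ∧ f e.1 < f e.2 ∧ ∃ w, f e.1 < f w ∧ f w < f e.2

/-- The half-vertices touched by a set of pairs. -/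
def nd {V : Type} (F : Finset (V × V)) : Finset (V × Bool) :=
  F.image (fun e => (e.1, true)) ∪ F.image (fun e => (e.2, false))

def PkProp {V : Type} [Fintype V] (G : SimpleGraph V) (k : ℕ) (f : V → ℚ) : Prop :=
  ∀ F ⊆ NF G f, F.card ≤ 2 * (nd F).card + k

def dl {V : Type} [Fintype V] (G : SimpleGraph V) (f : V → ℚ) (v : V) : ℤ :=
  ((Finset.univ.filter fun z => G.Adj v z ∧ f v < f z).card : ℤ) -
    ((Finset.univ.filter fun z => G.Adj v z ∧ f z < f v).card : ℤ)

def Phi {V : Type} [Fintype V] (G : SimpleGraph V) (f : V → ℚ) : ℕ :=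
  ∑ v, (dl G f v).natAbs

lemma nd_union {V : Type} (F F' : Finset (V × V)) : nd (F ∪ F') = nd F ∪ nd F' := by
  unfold nd; ext x; simp only [Finset.mem_union, Finset.mem_image]; grind

lemma nd_mono {V : Type} {F F' : Finset (V × V)} (h : F ⊆ F') : nd F ⊆ nd F' := by
  unfold nd; exact Finset.union_subset_union (Finset.image_subset_image h) (Finset.image_subset_image h)

lemma nd_super {V : Type} (F F' : Finset (V × V)) :
    (nd (F ∪ F')).card + (nd (F ∩ F')).card ≤ (nd F).card + (nd F').card := by
  rw [nd_union, ← Finset.card_union_add_card_inter (nd F) (nd F')]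
  gcongr
  exact Finset.subset_inter (nd_mono Finset.inter_subset_left) (nd_mono Finset.inter_subset_right)

lemma nd_card {V : Type} (F : Finset (V × V)) :
    (nd F).card = (F.image Prod.fst).card + (F.image Prod.snd).card := by
  unfold nd
  rw [Finset.card_union_of_disjoint]
  · congr 1
    · rw [← Finset.card_image_of_injective (F.image Prod.fst)
        (f := fun v => (v, true)) (fun a b h => by simpa using h), Finset.image_image]
      rfl
    · rw [← Finset.card_image_of_injective (F.image Prod.snd)
        (f := fun v => (v, false)) (fun a b h => by simpa using h), Finset.image_image]
      rfl
  · rw [Finset.disjoint_left]; intro x; simp only [Finset.mem_image]; grind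

/-- A minimal maximally deficient set. -/
def GoodD {V : Type} [Fintype V] (G : SimpleGraph V) (k : ℕ) (f : V → ℚ)
    (D : Finset (V × V)) : Prop :=
  D ⊆ NF G f ∧ D.card = 2 * (nd D).card + k ∧
    ∀ C ⊆ NF G f, ¬ D ⊆ C → C.card + 1 ≤ 2 * (nd C).card + k

lemma exists_goodD {V : Type} [Fintype V] (G : SimpleGraph V) (k : ℕ) (f : V → ℚ)
    (h1 : PkProp G (k + 1) f) (h0 : ¬ PkProp G k f) : ∃ D, GoodD G (k + 1) f D := by
  unfold PkProp at h0
  push Not at h0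
  obtain ⟨F, hF, hF2⟩ := h0
  have hne : ((NF G f).powerset.filter fun D => D.card = 2 * (nd D).card + (k + 1)).Nonempty :=
    ⟨F, by
      have := h1 F hF
      simp only [Finset.mem_filter, Finset.mem_powerset]; exact ⟨hF, by omega⟩⟩
  obtain ⟨D, hD, hmin⟩ := Finset.exists_min_image _ Finset.card hne
  simp only [Finset.mem_filter, Finset.mem_powerset] at hD hmin
  refine ⟨D, hD.1, hD.2, ?_⟩
  intro C hC hDC
  by_contra hcon
  have hCk := h1 C hC
  have hC2 : C.card = 2 * (nd C).card + (k + 1) := by omega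
  have hs := nd_super C D
  have hu := h1 (C ∪ D) (Finset.union_subset hC hD.1)
  have hi := h1 (C ∩ D) (Finset.inter_subset_left.trans hC)
  have hcard := Finset.card_union_add_card_inter C D
  have hm := hmin (C ∩ D) ⟨Finset.inter_subset_left.trans hC, by have := hD.2; omega⟩
  have : C ∩ D = D := Finset.eq_of_subset_of_card_le Finset.inter_subset_right hm
  exact hDC (this ▸ Finset.inter_subset_left)

lemma pk_sub {V : Type} [Fintype V] {G : SimpleGraph V} {k : ℕ} {f : V → ℚ}
    {D : Finset (V × V)} (hD : GoodD G k f D) {e1 : V × V} (he1 : e1 ∈ D)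
    (N' B : Finset (V × V)) (u : V)
    (hN' : ∀ e ∈ N', e.2 = u ∨ (e ∈ NF G f ∧ e ≠ e1) ∨ e ∈ B)
    (hA : (N'.filter fun e => e.2 = u).card ≤ 2) :
    ∀ F ⊆ N', F.card + 1 ≤ 2 * (nd F).card + k + B.card := by
  intro F hF
  set A := F.filter fun e => e.2 = u with hAdef
  set C := F.filter fun e => e.2 ≠ u ∧ e ∉ B with hCdef
  have h1 : F.card ≤ A.card + C.card + B.card := by
    calc F.card ≤ ((A ∪ C) ∪ B).card := by
          apply Finset.card_le_card
          intro e he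
          simp only [Finset.mem_union, hAdef, hCdef, Finset.mem_filter]
          tauto
      _ ≤ _ := by
          refine (Finset.card_union_le _ _).trans ?_
          gcongr
          exact Finset.card_union_le _ _
  have hCN : C ⊆ NF G f := by
    intro e he
    simp only [hCdef, Finset.mem_filter] at he
    rcases hN' e (hF he.1) with h | h | h
    · exact absurd h he.2.1
    · exact h.1
    · exact absurd h he.2.2
  have hC1 : ¬ D ⊆ C := by
    intro h
    have he := h he1
    simp only [hCdef, Finset.mem_filter] at he
    rcases hN' e1 (hF he.1) with h | h | h
    · exact absurd h he.2.1
    · exact h.2 rfl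
    · exact absurd h he.2.2
  have h2 := hD.2.2 C hCN hC1
  have hA2 : A.card ≤ 2 :=
    (Finset.card_le_card (Finset.filter_subset_filter _ hF)).trans hA
  have hCF : nd C ⊆ nd F := nd_mono (Finset.filter_subset _ _)
  rcases Finset.eq_empty_or_nonempty A with h | ⟨a, ha⟩
  · have := Finset.card_le_card hCF
    rw [h] at h1; simp at h1; omega
  · have hu : (u, false) ∉ nd C := by
      simp [nd, hCdef]
    have hu2 : (u, false) ∈ nd F := by
      simp only [hAdef, Finset.mem_filter] at ha
      simp only [nd, Finset.mem_union, Finset.mem_image]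
      right; exact ⟨a, ha.1, by rw [ha.2]⟩
    have := Finset.card_le_card (Finset.insert_subset hu2 hCF)
    rw [Finset.card_insert_of_notMem hu] at this
    omega

lemma goodD_fst {V : Type} [Fintype V] {G : SimpleGraph V} {k : ℕ} {f : V → ℚ}
    {D : Finset (V × V)} (hD : GoodD G (k+1) f D) :
    (∃ u, 5 ≤ (D.filter fun e => e.1 = u).card) ∨ (∃ u, 5 ≤ (D.filter fun e => e.2 = u).card) := by
  by_contra hcon
  push Not at hcon
  have h1 := Finset.card_le_mul_card_image (f := Prod.fst) D 4
    (fun b _ => by have := hcon.1 b; omega)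
  have h2 := Finset.card_le_mul_card_image (f := Prod.snd) D 4
    (fun b _ => by have := hcon.2 b; omega)
  have h3 := nd_card D
  have h4 := hD.2.1
  omega

lemma goodD_snd3 {V : Type} [Fintype V] {G : SimpleGraph V} {k : ℕ} {f : V → ℚ}
    {D : Finset (V × V)} (hD : GoodD G k f D) {e : V × V} (he : e ∈ D) :
    3 ≤ (D.filter fun e' => e'.2 = e.2).card := by
  set C := D.filter fun e' => ¬ e'.2 = e.2 with hC
  have h1 : (D.filter fun e' => e'.2 = e.2).card + C.card = D.card :=
    Finset.card_filter_add_card_filter_not _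
  have h2 := hD.2.2 C ((Finset.filter_subset _ _).trans hD.1) (by
    intro h; have := h he; simp [hC] at this)
  have hu : (e.2, false) ∉ nd C := by
    simp only [nd, hC, Finset.mem_union, Finset.mem_image, Finset.mem_filter]
    grind
  have hu2 : (e.2, false) ∈ nd D := by
    simp only [nd, Finset.mem_union, Finset.mem_image]
    right; exact ⟨e, he, rfl⟩
  have := Finset.card_le_card (Finset.insert_subset hu2 (nd_mono (Finset.filter_subset _ _ : C ⊆ D)))
  rw [Finset.card_insert_of_notMem hu] at this
  have := hD.2.1
  omega

lemma q_before {V : Type} [Fintype V] (f : V → ℚ) (t : ℚ) :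
    ∃ q, q < t ∧ ∀ z, f z < t → f z < q := by
  obtain ⟨q, h1, h2⟩ := Order.exists_between_finsets
    (lo := (Finset.univ.image f).filter (· < t)) (hi := {t}) (by
      intro x hx y hy; simp at hx hy; rw [hy]; exact hx.2)
  refine ⟨q, h2 t (by simp), fun z hz => h1 _ (by simp [hz])⟩

lemma q_after {V : Type} [Fintype V] (f : V → ℚ) (t : ℚ) :
    ∃ q, t < q ∧ ∀ z, t < f z → q < f z := by
  obtain ⟨q, h1, h2⟩ := Order.exists_between_finsets
    (hi := (Finset.univ.image f).filter (t < ·)) (lo := {t}) (by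
      intro x hx y hy; simp at hx hy; rw [hx]; exact hy.2)
  refine ⟨q, h1 t (by simp), fun z hz => h2 _ (by simp [hz])⟩

lemma mem_NF {V : Type} [Fintype V] {G : SimpleGraph V} {f : V → ℚ} {x y : V} :
    (x, y) ∈ NF G f ↔ G.Adj x y ∧ f x < f y ∧ ∃ w, f x < f w ∧ f w < f y := by
  simp [NF]

/-- counting: few neighbours lie before the nearest of five far neighbours -/
lemma count_before {V : Type} [Fintype V] {G : SimpleGraph V}
    (hdeg : ∀ v, (Finset.univ.filter fun z => G.Adj v z).card ≤ 7) {f : V → ℚ}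
    {D : Finset (V × V)} (hDN : D ⊆ NF G f) {u w1 : V}
    (h5 : 5 ≤ (D.filter fun e => e.1 = u).card)
    (hmin : ∀ b, (u, b) ∈ D → f w1 ≤ f b) (N' : Finset (V × V))
    (hN : ∀ z, (z, u) ∈ N' → G.Adj z u ∧ f z < f w1) :
    (N'.filter fun e => e.2 = u).card ≤ 2 := by
  have h1 : (N'.filter fun e => e.2 = u).card ≤
      (Finset.univ.filter fun z => G.Adj u z ∧ f z < f w1).card := by
    apply Finset.card_le_card_of_injOn Prod.fst
    · rintro ⟨x, y⟩ h
      simp only [Finset.coe_filter, Set.mem_ofPred_eq] at h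
      obtain ⟨h, rfl⟩ := h
      simp only [Finset.coe_filter, Set.mem_ofPred_eq, Finset.mem_univ, true_and]
      exact ⟨(hN x h).1.symm, (hN x h).2⟩
    · rintro ⟨x, y⟩ h ⟨x', y'⟩ h' hh
      simp only [Finset.coe_filter, Set.mem_ofPred_eq] at h h' hh
      simp [h.2, h'.2, hh]
  have h2 : (D.filter fun e => e.1 = u).card ≤
      (Finset.univ.filter fun z => G.Adj u z ∧ ¬ f z < f w1).card := by
    apply Finset.card_le_card_of_injOn Prod.snd
    · rintro ⟨x, y⟩ h
      simp only [Finset.coe_filter, Set.mem_ofPred_eq] at h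
      obtain ⟨h, rfl⟩ := h
      simp only [Finset.coe_filter, Set.mem_ofPred_eq, Finset.mem_univ, true_and]
      exact ⟨(mem_NF.1 (hDN h)).1, not_lt.2 (hmin _ h)⟩
    · rintro ⟨x, y⟩ h ⟨x', y'⟩ h' hh
      simp only [Finset.coe_filter, Set.mem_ofPred_eq] at h h' hh
      simp [h.2, h'.2, hh]
  have h3 := Finset.card_filter_add_card_filter_not (s := Finset.univ.filter fun z => G.Adj u z)
    (fun z => f z < f w1)
  rw [Finset.filter_filter, Finset.filter_filter] at h3
  have := hdeg u
  omega

lemma improve_before {V : Type} [Fintype V] {G : SimpleGraph V}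
    (hdeg : ∀ v, (Finset.univ.filter fun z => G.Adj v z).card ≤ 7) {f : V → ℚ}
    (hf : Function.Injective f) {k : ℕ} {D : Finset (V × V)} (hD : GoodD G (k + 1) f D) {u w1 : V}
    (h5 : 5 ≤ (D.filter fun e => e.1 = u).card) (hw : (u, w1) ∈ D)
    (hmin : ∀ b, (u, b) ∈ D → f w1 ≤ f b)
    (hno : ∀ a, G.Adj a w1 → f a < f w1 → ∃ z, f a < f z ∧ f z < f w1) :
    ∃ f' : V → ℚ, Function.Injective f' ∧ PkProp G k f' := by
  obtain ⟨q, hq1, hq2⟩ := q_before f (f w1)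
  have hw1 := mem_NF.1 (hD.1 hw)
  have hfu : Function.update f u q u = q := Function.update_self ..
  have hfz : ∀ z, z ≠ u → Function.update f u q z = f z := fun z hz => Function.update_of_ne hz ..
  generalize Function.update f u q = f' at *
  have hqne : ∀ z, f z ≠ q := by
    intro z h
    rcases lt_or_ge (f z) (f w1) with h' | h'
    · have := hq2 z h'; linarith
    · linarith
  have hw1u : w1 ≠ u := by rintro rfl; exact hw1.1.ne rfl
  refine ⟨f', ?_, ?_⟩
  · intro x y hxy
    by_cases hx : x = u <;> by_cases hy : y = u
    · rw [hx, hy]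
    · subst hx; rw [hfu, hfz y hy] at hxy; exact absurd hxy.symm (hqne y)
    · subst hy; rw [hfu, hfz x hx] at hxy; exact absurd hxy (hqne x)
    · rw [hfz y hy, hfz x hx] at hxy; exact hf hxy
  · intro F hF
    have := pk_sub hD hw (NF G f') ∅ u ?_ ?_ F hF
    · simp at this; omega
    · rintro ⟨x, y⟩ he
      obtain ⟨ha, hlt, w, hwx, hwy⟩ := mem_NF.1 he
      by_cases hy : y = u
      · left; exact hy
      right; left
      rw [hfz y hy] at hlt hwy
      by_cases hx : x = u
      · subst hx
        rw [hfu] at hlt hwx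
        have hwu : w ≠ x := by rintro rfl; rw [hfu] at hwx; exact lt_irrefl _ hwx
        rw [hfz w hwu] at hwx hwy
        have h1 : f w1 ≤ f w := by
          by_contra h; have := hq2 w (not_le.1 h); linarith
        refine ⟨mem_NF.2 ⟨ha, by linarith, w1, hw1.2.1, by linarith⟩, ?_⟩
        intro h; simp at h; subst h; linarith
      · rw [hfz x hx] at hlt hwx
        refine ⟨?_, fun h => hx (by simpa using (congrArg Prod.fst h))⟩
        by_cases hwu : w = u
        · subst hwu
          rw [hfu] at hwx hwy
          have h1 : f w1 ≤ f y := by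
            by_contra h; have := hq2 y (not_le.1 h); linarith
          by_cases hyw : y = w1
          · subst hyw
            exact mem_NF.2 ⟨ha, hlt, hno x ha hlt⟩
          · have : f w1 < f y := lt_of_le_of_ne h1 (fun h => hyw (hf h).symm)
            exact mem_NF.2 ⟨ha, hlt, w1, by linarith, this⟩
        · rw [hfz w hwu] at hwx hwy
          exact mem_NF.2 ⟨ha, hlt, w, hwx, hwy⟩
    · apply count_before hdeg hD.1 h5 hmin
      intro z hz
      obtain ⟨ha, hlt, -⟩ := mem_NF.1 hz
      refine ⟨ha, ?_⟩
      rw [hfu, hfz z ha.ne] at hlt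
      linarith

lemma improve_after {V : Type} [Fintype V] {G : SimpleGraph V}
    (hdeg : ∀ v, (Finset.univ.filter fun z => G.Adj v z).card ≤ 7) {f : V → ℚ}
    (hf : Function.Injective f) {k : ℕ} {D : Finset (V × V)} (hD : GoodD G (k + 1) f D) {u w1 a : V}
    (h5 : 5 ≤ (D.filter fun e => e.1 = u).card) (hw : (u, w1) ∈ D)
    (hmin : ∀ b, (u, b) ∈ D → f w1 ≤ f b)
    (haw : G.Adj a w1) (haw2 : f a < f w1) (haw3 : ∀ z, ¬ (f a < f z ∧ f z < f w1)) :
    ∃ f' : V → ℚ, Function.Injective f' ∧ PkProp G (k + 1) f' ∧ Phi G f' < Phi G f := by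
  obtain ⟨q, hq1, hq2⟩ := q_after f (f w1)
  have hw1 := mem_NF.1 (hD.1 hw)
  have hfu : Function.update f u q u = q := Function.update_self ..
  have hfz : ∀ z, z ≠ u → Function.update f u q z = f z := fun z hz => Function.update_of_ne hz ..
  generalize Function.update f u q = f' at *
  have hqne : ∀ z, f z ≠ q := by
    intro z h
    rcases lt_or_ge (f w1) (f z) with h' | h'
    · have := hq2 z h'; linarith
    · linarith
  have hqlt : ∀ z, f z < q ↔ f z ≤ f w1 := fun z =>
    ⟨fun h => by by_contra h'; have := hq2 z (not_le.1 h'); linarith, fun h => by linarith⟩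
  have hqgt : ∀ z, q < f z ↔ f w1 < f z := fun z => ⟨fun h => by linarith, hq2 z⟩
  have hw1u : w1 ≠ u := by rintro rfl; exact hw1.1.ne rfl
  refine ⟨f', ?_, ?_, ?_⟩
  · intro x y hxy
    by_cases hx : x = u <;> by_cases hy : y = u
    · rw [hx, hy]
    · subst hx; rw [hfu, hfz y hy] at hxy; exact absurd hxy.symm (hqne y)
    · subst hy; rw [hfu, hfz x hx] at hxy; exact absurd hxy (hqne x)
    · rw [hfz y hy, hfz x hx] at hxy; exact hf hxy
  · intro F hF
    set B : Finset (V × V) := Finset.univ.filter fun e =>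
      e.1 = w1 ∧ f w1 < f e.2 ∧ ∀ z, ¬ (f w1 < f z ∧ f z < f e.2) with hB
    have hBc : B.card ≤ 1 := by
      rw [Finset.card_le_one]
      rintro ⟨x, y⟩ h ⟨x', y'⟩ h'
      simp only [hB, Finset.mem_filter, Finset.mem_univ, true_and] at h h'
      obtain ⟨rfl, h1, h2⟩ := h
      obtain ⟨rfl, h1', h2'⟩ := h'
      have : f y = f y' := by
        apply le_antisymm
        · by_contra hh; exact h2 y' ⟨h1', not_le.1 hh⟩
        · by_contra hh; exact h2' y ⟨h1, not_le.1 hh⟩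
      rw [hf this]
    have := pk_sub hD hw (NF G f') B u ?_ ?_ F hF
    · omega
    · rintro ⟨x, y⟩ he
      obtain ⟨ha, hlt, w, hwx, hwy⟩ := mem_NF.1 he
      by_cases hy : y = u
      · left; exact hy
      right
      rw [hfz y hy] at hlt hwy
      by_cases hx : x = u
      · subst hx
        rw [hfu] at hlt hwx
        have hyw := (hqgt y).1 hlt
        left
        refine ⟨mem_NF.2 ⟨ha, by linarith, w1, hw1.2.1, hyw⟩, ?_⟩
        intro h; simp at h; subst h; linarith
      · rw [hfz x hx] at hlt hwx
        have hne : (x, y) ≠ (u, w1) := fun h => hx (by simpa using (congrArg Prod.fst h))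
        by_cases hwu : w = u
        · subst hwu
          rw [hfu] at hwx hwy
          have h1 := (hqlt x).1 hwx
          have h2 := (hqgt y).1 hwy
          by_cases hxw : x = w1
          · subst hxw
            by_cases hz : ∃ z, f x < f z ∧ f z < f y
            · left; exact ⟨mem_NF.2 ⟨ha, hlt, hz⟩, hne⟩
            · right
              simp only [hB, Finset.mem_filter, Finset.mem_univ, true_and]
              exact ⟨h2, fun z hz' => hz ⟨z, hz'⟩⟩
          · left
            have : f x < f w1 := lt_of_le_of_ne h1 (fun h => hxw (hf h))
            exact ⟨mem_NF.2 ⟨ha, hlt, w1, this, h2⟩, hne⟩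
        · rw [hfz w hwu] at hwx hwy
          left
          exact ⟨mem_NF.2 ⟨ha, hlt, w, hwx, hwy⟩, hne⟩
    · apply count_before hdeg hD.1 h5 hmin
      intro z hz
      obtain ⟨ha, hlt, w, hwx, hwy⟩ := mem_NF.1 hz
      refine ⟨ha, ?_⟩
      rw [hfz z ha.ne] at hlt hwx
      rw [hfu] at hlt hwy
      have hwu : w ≠ u := by rintro rfl; rw [hfu] at hwy; exact lt_irrefl _ hwy
      rw [hfz w hwu] at hwx hwy
      have := (hqlt w).1 hwy
      linarith
  · set Fl : Finset V := Finset.univ.filter fun z => G.Adj u z ∧ f u < f z ∧ f z ≤ f w1 with hFl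
    have hw1F : w1 ∈ Fl := by simp [hFl, hw1.1, hw1.2.1]
    have huF : u ∉ Fl := by simp [hFl]
    have hsplit : ∀ v, (Finset.univ.filter fun z => G.Adj v z ∧ f v < f z).card +
        (Finset.univ.filter fun z => G.Adj v z ∧ f z < f v).card ≤ 7 := by
      intro v
      rw [← Finset.card_union_of_disjoint]
      · refine (Finset.card_le_card ?_).trans (hdeg v)
        intro z; simp only [Finset.mem_union, Finset.mem_filter]; tauto
      · rw [Finset.disjoint_left]; intro z; simp only [Finset.mem_filter]
        rintro ⟨-, -, h⟩ ⟨-, -, h'⟩; linarith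
    have hdu : dl G f' u = dl G f u - 2 * Fl.card := by
      have e1 : (Finset.univ.filter fun z => G.Adj u z ∧ f u < f z) =
          (Finset.univ.filter fun z => G.Adj u z ∧ f' u < f' z) ∪ Fl := by
        ext z
        simp only [hFl, Finset.mem_union, Finset.mem_filter, Finset.mem_univ, true_and]
        constructor
        · rintro ⟨h1, h2⟩
          rw [hfu, hfz z h1.ne', hqgt]
          rcases lt_or_ge (f w1) (f z) with h | h
          · left; exact ⟨h1, h⟩
          · right; exact ⟨h1, h2, h⟩
        · rintro (⟨h1, h2⟩ | h)
          · rw [hfu, hfz z h1.ne', hqgt] at h2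
            exact ⟨h1, by linarith⟩
          · exact ⟨h.1, h.2.1⟩
      have d1 : Disjoint (Finset.univ.filter fun z => G.Adj u z ∧ f' u < f' z) Fl := by
        rw [Finset.disjoint_left]; intro z; simp only [hFl, Finset.mem_filter]
        rintro ⟨-, h1, h⟩ ⟨-, -, -, h'⟩
        rw [hfu, hfz z h1.ne', hqgt] at h; linarith
      have e2 : (Finset.univ.filter fun z => G.Adj u z ∧ f' z < f' u) =
          (Finset.univ.filter fun z => G.Adj u z ∧ f z < f u) ∪ Fl := by
        ext z
        simp only [hFl, Finset.mem_union, Finset.mem_filter, Finset.mem_univ, true_and]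
        constructor
        · rintro ⟨h1, h2⟩
          rw [hfu, hfz z h1.ne', hqlt] at h2
          rcases lt_trichotomy (f u) (f z) with h | h | h
          · right; exact ⟨h1, h, h2⟩
          · exact absurd (hf h) h1.ne
          · left; exact ⟨h1, h⟩
        · rintro (⟨h1, h2⟩ | h)
          · rw [hfu, hfz z h1.ne', hqlt]
            exact ⟨h1, by linarith⟩
          · rw [hfu, hfz z h.1.ne', hqlt]
            exact ⟨h.1, h.2.2⟩
      have d2 : Disjoint (Finset.univ.filter fun z => G.Adj u z ∧ f z < f u) Fl := by
        rw [Finset.disjoint_left]; intro z; simp only [hFl, Finset.mem_filter]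
        rintro ⟨-, h1, h⟩ ⟨-, -, h', -⟩
        linarith
      unfold dl
      rw [e1, e2, Finset.card_union_of_disjoint d1, Finset.card_union_of_disjoint d2]
      push_cast; ring
    have hdF : ∀ z ∈ Fl, dl G f' z = dl G f z + 2 := by
      intro z hz
      simp only [hFl, Finset.mem_filter, Finset.mem_univ, true_and] at hz
      have hzu : z ≠ u := hz.1.ne'
      have e1 : (Finset.univ.filter fun y => G.Adj z y ∧ f' z < f' y) =
          insert u (Finset.univ.filter fun y => G.Adj z y ∧ f z < f y) := by
        ext y
        simp only [Finset.mem_insert, Finset.mem_filter, Finset.mem_univ, true_and]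
        by_cases hy : y = u
        · subst hy; simp [hfu, hfz z hzu, hqlt, hz.1.symm, hz.2.2]
        · simp [hy, hfz z hzu, hfz y hy]
      have e2 : (Finset.univ.filter fun y => G.Adj z y ∧ f y < f z) =
          insert u (Finset.univ.filter fun y => G.Adj z y ∧ f' y < f' z) := by
        ext y
        simp only [Finset.mem_insert, Finset.mem_filter, Finset.mem_univ, true_and]
        by_cases hy : y = u
        · subst hy; simp [hz.1.symm, hz.2.1]
        · simp [hy, hfz z hzu, hfz y hy]
      unfold dl
      rw [e1, e2, Finset.card_insert_of_notMem, Finset.card_insert_of_notMem]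
      · push_cast; ring
      · simp only [Finset.mem_filter, hfu, hfz z hzu]; rintro ⟨-, -, h⟩
        rw [hqgt] at h; linarith
      · simp only [Finset.mem_filter]; rintro ⟨-, -, h⟩; linarith
    have hdo : ∀ z, z ≠ u → z ∉ Fl → dl G f' z = dl G f z := by
      intro z hzu hz
      have key : ∀ y, G.Adj z y → ((f' z < f' y ↔ f z < f y) ∧ (f' y < f' z ↔ f y < f z)) := by
        intro y hzy
        by_cases hy : y = u
        · subst hy
          simp only [hFl, Finset.mem_filter, Finset.mem_univ, true_and] at hz
          rw [hfu, hfz z hzu, hqlt, hqgt]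
          rcases lt_trichotomy (f y) (f z) with h | h | h
          · have : f w1 < f z := by
              by_contra h'; exact hz ⟨hzy.symm, h, not_lt.1 h'⟩
            constructor
            · constructor <;> intro <;> linarith
            · constructor <;> intro <;> linarith
          · exact absurd (hf h) hzu.symm
          · constructor
            · constructor <;> intro <;> linarith
            · constructor <;> intro <;> linarith
        · rw [hfz z hzu, hfz y hy]; simp
      unfold dl
      congr 3
      · ext y; simp only [Finset.mem_filter, Finset.mem_univ, true_and]
        exact and_congr_right fun h => (key y h).1
      · ext y; simp only [Finset.mem_filter, Finset.mem_univ, true_and]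
        exact and_congr_right fun h => (key y h).2
    have hbu : 2 * (Fl.card : ℤ) ≤ dl G f u := by
      set S : Finset V := (D.filter fun e => e.1 = u).image Prod.snd with hS
      have hSc : S.card = (D.filter fun e => e.1 = u).card := by
        apply Finset.card_image_of_injOn
        rintro ⟨x, y⟩ h ⟨x', y'⟩ h' hh
        simp only [Finset.coe_filter, Set.mem_ofPred_eq] at h h' hh
        simp [h.2, h'.2, hh]
      have hSm : ∀ z ∈ S, (u, z) ∈ D := by
        intro z hz
        simp only [hS, Finset.mem_image, Finset.mem_filter] at hz
        obtain ⟨⟨x, y⟩, ⟨h1, h2⟩, h3⟩ := hz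
        simp only at h2 h3
        rw [← h2, ← h3]; exact h1
      have hi : (Fl ∩ S).card ≤ 1 := by
        rw [Finset.card_le_one]
        have : ∀ z ∈ Fl ∩ S, z = w1 := by
          intro z hz
          rw [Finset.mem_inter] at hz
          have h1 := hmin z (hSm z hz.2)
          have h2 := hz.1
          simp only [hFl, Finset.mem_filter] at h2
          exact hf (le_antisymm h2.2.2.2 h1)
        intro x hx y hy
        rw [this x hx, this y hy]
      have hR : (Fl ∪ S).card ≤ (Finset.univ.filter fun z => G.Adj u z ∧ f u < f z).card := by
        apply Finset.card_le_card
        intro z hz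
        rw [Finset.mem_union] at hz
        simp only [Finset.mem_filter, Finset.mem_univ, true_and]
        rcases hz with hz | hz
        · simp only [hFl, Finset.mem_filter] at hz; exact ⟨hz.2.1, hz.2.2.1⟩
        · have := mem_NF.1 (hD.1 (hSm z hz)); exact ⟨this.1, this.2.1⟩
      have := Finset.card_union_add_card_inter Fl S
      have := hsplit u
      unfold dl; omega
    have hbw : dl G f w1 ≤ -1 := by
      have h3 := goodD_snd3 hD hw
      simp only at h3
      set S : Finset V := (D.filter fun e => e.2 = w1).image Prod.fst with hS
      have hSc : S.card = (D.filter fun e => e.2 = w1).card := by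
        apply Finset.card_image_of_injOn
        rintro ⟨x, y⟩ h ⟨x', y'⟩ h' hh
        simp only [Finset.coe_filter, Set.mem_ofPred_eq] at h h' hh
        simp [h.2, h'.2, hh]
      have hSm : ∀ z ∈ S, (z, w1) ∈ D := by
        intro z hz
        simp only [hS, Finset.mem_image, Finset.mem_filter] at hz
        obtain ⟨⟨x, y⟩, ⟨h1, h2⟩, h3⟩ := hz
        simp only at h2 h3
        rw [← h2, ← h3]; exact h1
      have haS : a ∉ S := by
        intro h
        obtain ⟨z, hz⟩ := (mem_NF.1 (hD.1 (hSm a h))).2.2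
        exact haw3 z hz
      have hR : (insert a S).card ≤ (Finset.univ.filter fun z => G.Adj w1 z ∧ f z < f w1).card := by
        apply Finset.card_le_card
        intro z hz
        rw [Finset.mem_insert] at hz
        simp only [Finset.mem_filter, Finset.mem_univ, true_and]
        rcases hz with rfl | hz
        · exact ⟨haw.symm, haw2⟩
        · have := mem_NF.1 (hD.1 (hSm z hz)); exact ⟨this.1.symm, this.2.1⟩
      rw [Finset.card_insert_of_notMem haS] at hR
      have := hsplit w1
      unfold dl; omega
    have hpt : ∀ z, ((dl G f' z).natAbs : ℤ) ≤ (dl G f z).natAbs +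
        (if z ∈ Fl.erase w1 then 2 else 0) - (if z = u then 2 * (Fl.card : ℤ) else 0) := by
      intro z
      by_cases hzu : z = u
      · subst hzu
        have : z ∉ Fl.erase w1 := fun h => huF (Finset.mem_of_mem_erase h)
        simp only [this, if_true, if_false]
        rw [hdu]; omega
      · by_cases hz : z ∈ Fl
        · by_cases hzw : z = w1
          · subst hzw; have := hdF z hz; rw [if_neg (by simp), if_neg hzu]; omega
          · have := hdF z hz; rw [if_pos (by simp [hz, hzw]), if_neg hzu]; omega
        · have := hdo z hzu hz; simp [hzu, hz, this]
    have hsum := Finset.sum_le_sum (s := Finset.univ) fun z _ => hpt z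
    rw [Finset.sum_sub_distrib, Finset.sum_add_distrib] at hsum
    simp only [Finset.sum_ite_mem, Finset.sum_ite_eq', Finset.mem_univ, if_true, Finset.univ_inter,
      Finset.sum_const, nsmul_eq_mul] at hsum
    rw [Finset.card_erase_of_mem hw1F] at hsum
    have hpos : 0 < Fl.card := Finset.card_pos.2 ⟨w1, hw1F⟩
    unfold Phi
    zify
    push_cast [Nat.cast_sub hpos] at hsum
    linarith

lemma improve_fst {V : Type} [Fintype V] {G : SimpleGraph V}
    (hdeg : ∀ v, (Finset.univ.filter fun z => G.Adj v z).card ≤ 7) {f : V → ℚ}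
    (hf : Function.Injective f) {k : ℕ} {D : Finset (V × V)} (hD : GoodD G (k + 1) f D) {u : V}
    (h5 : 5 ≤ (D.filter fun e => e.1 = u).card) :
    ∃ f' : V → ℚ, Function.Injective f' ∧
      (PkProp G k f' ∨ (PkProp G (k + 1) f' ∧ Phi G f' < Phi G f)) := by
  obtain ⟨⟨x, w1⟩, he, hmin⟩ := Finset.exists_min_image (D.filter fun e => e.1 = u)
    (fun e => f e.2) (Finset.card_pos.1 (by omega))
  simp only [Finset.mem_filter] at he hmin
  obtain ⟨hw, rfl⟩ := he
  have hmin' : ∀ b, (x, b) ∈ D → f w1 ≤ f b := fun b hb => hmin (x, b) ⟨hb, rfl⟩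
  by_cases hno : ∀ a, G.Adj a w1 → f a < f w1 → ∃ z, f a < f z ∧ f z < f w1
  · obtain ⟨f', h1, h2⟩ := improve_before hdeg hf hD h5 hw hmin' hno
    exact ⟨f', h1, Or.inl h2⟩
  · push Not at hno
    obtain ⟨a, h1, h2, h3⟩ := hno
    obtain ⟨f', h1, h2⟩ := improve_after hdeg hf hD h5 hw hmin' h1 h2
      (fun z hz => absurd hz.2 (not_lt.2 (h3 z hz.1)))
    exact ⟨f', h1, Or.inr h2⟩

lemma swap_NF {V : Type} [Fintype V] (G : SimpleGraph V) (f : V → ℚ) (F : Finset (V × V))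
    (hF : F ⊆ NF G f) : F.image Prod.swap ⊆ NF G (fun v => - f v) := by
  rintro ⟨x, y⟩ h
  simp only [Finset.mem_image, Prod.exists, Prod.swap_prod_mk, Prod.mk.injEq] at h
  obtain ⟨a, b, h, rfl, rfl⟩ := h
  obtain ⟨h1, h2, w, h3, h4⟩ := mem_NF.1 (hF h)
  exact mem_NF.2 ⟨h1.symm, by linarith, w, by linarith, by linarith⟩

lemma swap_nd {V : Type} (F : Finset (V × V)) : (nd (F.image Prod.swap)).card = (nd F).card := by
  rw [nd_card, nd_card, Finset.image_image, Finset.image_image, add_comm]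
  rfl

lemma swap_card {V : Type} (F : Finset (V × V)) : (F.image Prod.swap).card = F.card :=
  Finset.card_image_of_injective _ Prod.swap_injective

lemma swap_swap {V : Type} (F : Finset (V × V)) : (F.image Prod.swap).image Prod.swap = F := by
  rw [Finset.image_image, Prod.swap_swap_eq, Finset.image_id]

lemma phi_neg {V : Type} [Fintype V] (G : SimpleGraph V) (f : V → ℚ) :
    Phi G (fun v => - f v) = Phi G f := by
  unfold Phi
  apply Finset.sum_congr rfl
  intro v _
  unfold dl
  simp only [neg_lt_neg_iff]
  omega

lemma goodD_neg {V : Type} [Fintype V] {G : SimpleGraph V} {k : ℕ} {f : V → ℚ}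
    {D : Finset (V × V)} (hD : GoodD G k f D) :
    GoodD G k (fun v => - f v) (D.image Prod.swap) := by
  refine ⟨swap_NF G f D hD.1, ?_, ?_⟩
  · rw [swap_card, swap_nd]; exact hD.2.1
  · intro C hC hDC
    have h := swap_NF G _ C hC
    simp only [neg_neg] at h
    have := hD.2.2 _ h (fun h' => hDC (by
      have := Finset.image_subset_image (f := Prod.swap) h'
      rwa [swap_swap] at this))
    rwa [swap_card, swap_nd] at this

lemma improve {V : Type} [Fintype V] {G : SimpleGraph V}
    (hdeg : ∀ v, (Finset.univ.filter fun z => G.Adj v z).card ≤ 7) {f : V → ℚ}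
    (hf : Function.Injective f) {k : ℕ} {D : Finset (V × V)} (hD : GoodD G (k + 1) f D) :
    ∃ f' : V → ℚ, Function.Injective f' ∧
      (PkProp G k f' ∨ (PkProp G (k + 1) f' ∧ Phi G f' < Phi G f)) := by
  rcases goodD_fst hD with ⟨u, hu⟩ | ⟨u, hu⟩
  · exact improve_fst hdeg hf hD hu
  · rw [← phi_neg]
    refine improve_fst hdeg (fun a b h => hf (neg_injective h)) (goodD_neg hD) (u := u) ?_
    rw [← swap_card] at hu
    refine hu.trans (Finset.card_le_card ?_)
    intro e
    simp only [Finset.mem_image, Finset.mem_filter]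
    rintro ⟨a, ⟨h1, h2⟩, rfl⟩
    exact ⟨⟨a, h1, rfl⟩, h2⟩

lemma exists_pk0 {V : Type} [Fintype V] {G : SimpleGraph V}
    (hdeg : ∀ v, (Finset.univ.filter fun z => G.Adj v z).card ≤ 7) :
    ∃ f : V → ℚ, Function.Injective f ∧ PkProp G 0 f := by
  have main : ∀ k m : ℕ, ∀ f : V → ℚ, Function.Injective f → PkProp G k f → Phi G f ≤ m →
      ∃ f : V → ℚ, Function.Injective f ∧ PkProp G 0 f := by
    intro k
    induction k with
    | zero => intro m f h1 h2 _; exact ⟨f, h1, h2⟩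
    | succ k ih =>
      intro m
      induction m with
      | zero =>
        intro f h1 h2 h3
        by_cases h0 : PkProp G k f
        · exact ih _ f h1 h0 le_rfl
        · obtain ⟨D, hD⟩ := exists_goodD G k f h2 h0
          obtain ⟨f', h1', h | h⟩ := improve hdeg h1 hD
          · exact ih _ f' h1' h le_rfl
          · omega
      | succ m ihm =>
        intro f h1 h2 h3
        by_cases h0 : PkProp G k f
        · exact ih _ f h1 h0 le_rfl
        · obtain ⟨D, hD⟩ := exists_goodD G k f h2 h0
          obtain ⟨f', h1', h | h⟩ := improve hdeg h1 hD
          · exact ih _ f' h1' h le_rfl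
          · exact ihm f' h1' h.1 (by omega)
  have e := Fintype.equivFin V
  refine main (NF G (fun v => ((e v : ℕ) : ℚ))).card _ (fun v => ((e v : ℕ) : ℚ)) ?_ ?_ le_rfl
  · intro a b h
    exact e.injective (Fin.ext (by simpa using h))
  · intro F hF
    have := Finset.card_le_card hF
    omega

/-- The combinatorial output: an order `pos` and an injective port assignment. -/
lemma exists_ports {V : Type} [Fintype V] {G : SimpleGraph V}
    (hdeg : ∀ v, (Finset.univ.filter fun z => G.Adj v z).card ≤ 7) :
    ∃ (pos : V → ℕ) (g : V → V → V × Bool × Bool), Function.Injective pos ∧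
      (∀ v, pos v < Fintype.card V) ∧
      (∀ u v, G.Adj u v → pos u + 1 < pos v →
        (g u v).1 = u ∧ (g u v).2.1 = true ∨ (g u v).1 = v ∧ (g u v).2.1 = false) ∧
      (∀ u v u' v', G.Adj u v → pos u + 1 < pos v → G.Adj u' v' → pos u' + 1 < pos v' →
        g u v = g u' v' → u = u' ∧ v = v') := by
  obtain ⟨f, hf, hpk⟩ := exists_pk0 hdeg
  set pos : V → ℕ := fun v => (Finset.univ.filter fun w => f w < f v).card with hpos
  have hlt : ∀ u v, f u < f v → pos u < pos v := by
    intro u v h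
    apply Finset.card_lt_card
    rw [Finset.ssubset_iff_of_subset]
    · exact ⟨u, by simp [h], by simp⟩
    · intro z; simp only [Finset.mem_filter]; rintro ⟨-, h'⟩; exact ⟨Finset.mem_univ _, by linarith⟩
  have hlt' : ∀ u v, pos u < pos v → f u < f v := by
    intro u v h
    by_contra h'
    rcases lt_or_eq_of_le (not_lt.1 h') with h2 | h2
    · have := hlt _ _ h2; omega
    · rw [hf h2] at h; omega
  have hinj : Function.Injective pos := by
    intro u v h
    apply hf
    apply le_antisymm
    · by_contra h'; have := hlt _ _ (not_le.1 h'); omega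
    · by_contra h'; have := hlt _ _ (not_le.1 h'); omega
  have hNF : ∀ u v, G.Adj u v → pos u + 1 < pos v → (u, v) ∈ NF G f := by
    intro u v ha h
    refine mem_NF.2 ⟨ha, hlt' _ _ (by omega), ?_⟩
    by_contra hcon
    push Not at hcon
    have : (Finset.univ.filter fun w => f w < f v) ⊆
        insert u (Finset.univ.filter fun w => f w < f u) := by
      intro z
      simp only [Finset.mem_insert, Finset.mem_filter, Finset.mem_univ, true_and]
      intro hz
      rcases lt_trichotomy (f z) (f u) with h1 | h1 | h1
      · exact Or.inr h1
      · exact Or.inl (hf h1)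
      · exact absurd hz (not_lt.2 (hcon z h1))
    have := (Finset.card_le_card this).trans (Finset.card_insert_le _ _)
    simp only [hpos] at h
    omega
  let t : {e // e ∈ NF G f} → Finset (V × Bool × Bool) := fun e =>
    {(e.1.1, true, true), (e.1.1, true, false), (e.1.2, false, true), (e.1.2, false, false)}
  have hall := (Finset.all_card_le_biUnion_card_iff_exists_injective t).1 (by
    intro s
    have h1 := hpk (s.image Subtype.val) (by
      intro e he
      simp only [Finset.mem_image] at he
      obtain ⟨a, _, rfl⟩ := he; exact a.2)
    rw [Finset.card_image_of_injective _ Subtype.val_injective] at h1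
    have h2 : (nd (s.image Subtype.val) ×ˢ (Finset.univ : Finset Bool)).card ≤
        (s.biUnion t).card := by
      apply Finset.card_le_card_of_injOn (fun x => (x.1.1, x.1.2, x.2))
      · rintro ⟨⟨v, b⟩, i⟩ h
        simp only [nd, Finset.coe_product, Set.mem_prod, Finset.mem_coe, Finset.mem_union,
          Finset.mem_image, Prod.mk.injEq] at h
        simp only [Finset.coe_biUnion, Set.mem_iUnion, Finset.mem_coe]
        rcases h.1 with ⟨e, ⟨e', he', rfl⟩, rfl, rfl⟩ | ⟨e, ⟨e', he', rfl⟩, rfl, rfl⟩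
        · exact ⟨e', he', by cases i <;> simp [t]⟩
        · exact ⟨e', he', by cases i <;> simp [t]⟩
      · rintro ⟨⟨v, b⟩, i⟩ _ ⟨⟨v', b'⟩, i'⟩ _ h
        simp only [Prod.mk.injEq] at h ⊢
        tauto
    rw [Finset.card_product] at h2
    simp at h2
    omega)
  obtain ⟨g, hg1, hg2⟩ := hall
  refine ⟨pos, fun u v => if h : (u, v) ∈ NF G f then g ⟨(u, v), h⟩ else (u, true, true),
    hinj, ?_, ?_, ?_⟩
  · intro v
    apply Finset.card_lt_univ_of_notMem (x := v)
    simp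
  · intro u v ha h
    have h1 := hNF u v ha h
    have h2 := hg2 ⟨(u, v), h1⟩
    simp only [h1, dif_pos]
    simp only [t, Finset.mem_insert, Finset.mem_singleton] at h2
    rcases h2 with h2 | h2 | h2 | h2 <;> rw [h2] <;> simp
  · intro u v u' v' ha h ha' h' heq
    have h1 := hNF u v ha h
    have h1' := hNF u' v' ha' h'
    simp only [h1, h1', dif_pos] at heq
    have := congrArg Subtype.val (hg1 heq)
    simpa using this

/-! ### Part II: geometry of the drawing -/

/-- Real data of a slot layout: `b` are slot starts, `(X, Y)` the vertex positions, `Ab`, `Be`,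
`Fr` the ordered edges routed above the diagonal, below the diagonal and along the diagonal,
and `c`, `r` the column and the row used by an edge. -/
structure Lay (V : Type) where
  b : V → ℝ
  X : V → ℝ
  Y : V → ℝ
  Ab : V → V → Prop
  Be : V → V → Prop
  Fr : V → V → Prop
  c : V → V → ℝ
  r : V → V → ℝ
  sep : ∀ u w, u ≠ w → b u + 8 ≤ b w ∨ b w + 8 ≤ b u
  hX : ∀ u, b u < X u ∧ X u < b u + 8
  hY : ∀ u, b u < Y u ∧ Y u < b u + 8
  ab : ∀ u v, Ab u v → b u + 8 ≤ b v ∧ b u < c u v ∧ c u v < b u + 8 ∧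
    b v < r u v ∧ r u v < b v + 8
  be : ∀ u v, Be u v → b u + 8 ≤ b v ∧ b u < r u v ∧ r u v < b u + 8 ∧
    b v < c u v ∧ c u v < b v + 8
  fr : ∀ u v, Fr u v → b v = b u + 8
  abc : ∀ u v v', Ab u v → Ab u v' → b v < b v' → c u v' < c u v
  abr : ∀ u u' v, Ab u v → Ab u' v → b u < b u' → r u' v < r u v
  ber : ∀ u v v', Be u v → Be u v' → b v < b v' → r u v' < r u v
  bec : ∀ u u' v, Be u v → Be u' v → b u < b u' → c u' v < c u v

namespace Lay

variable {V : Type} (L : Lay V)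

def p (v : V) : Pt := (L.X v, L.Y v)

def Ex (u v w : V) (Q : Pt) : Prop :=
  (w = u ∧ ((L.Ab u v ∧ Q = (L.c u v, L.b u + 8)) ∨ (L.Be u v ∧ Q = (L.b u + 8, L.r u v)) ∨
    (L.Fr u v ∧ Q = (L.b u + 8, L.b u + 8)))) ∨
  (w = v ∧ ((L.Ab u v ∧ Q = (L.b v, L.r u v)) ∨ (L.Be u v ∧ Q = (L.c u v, L.b v)) ∨
    (L.Fr u v ∧ Q = (L.b v, L.b v))))

def InLoc (u v : V) (x : Pt) : Prop := ∃ w Q, L.Ex u v w Q ∧ x ∈ segment ℝ (L.p w) Q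

def InV (u v : V) (x : Pt) : Prop :=
  (L.Ab u v ∧ x.1 = L.c u v ∧ L.b u + 8 ≤ x.2 ∧ x.2 ≤ L.r u v) ∨
  (L.Be u v ∧ x.1 = L.c u v ∧ L.r u v ≤ x.2 ∧ x.2 ≤ L.b v)

def InH (u v : V) (x : Pt) : Prop :=
  (L.Ab u v ∧ x.2 = L.r u v ∧ L.c u v ≤ x.1 ∧ x.1 ≤ L.b v) ∨
  (L.Be u v ∧ x.2 = L.r u v ∧ L.b u + 8 ≤ x.1 ∧ x.1 ≤ L.c u v)

/-- transposition of a layout -/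
def tr : Lay V where
  b := L.b
  X := L.Y
  Y := L.X
  Ab := L.Be
  Be := L.Ab
  Fr := L.Fr
  c := L.r
  r := L.c
  sep := L.sep
  hX := L.hY
  hY := L.hX
  ab := L.be
  be := L.ab
  fr := L.fr
  abc := L.ber
  abr := L.bec
  ber := L.abc
  bec := L.abr

variable {L}

lemma slot {u w : V} {t : ℝ} (h1 : L.b u < t) (h2 : t < L.b u + 8) (h3 : L.b w < t)
    (h4 : t < L.b w + 8) : u = w := by
  by_contra h
  rcases L.sep u w h with h | h <;> linarith

lemma b_inj {u w : V} (h : L.b u = L.b w) : u = w := by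
  by_contra h'
  rcases L.sep u w h' with h | h <;> linarith

lemma ne_cases {u w : V} (h : u ≠ w) : L.b u < L.b w ∨ L.b w < L.b u := by
  rcases L.sep u w h with h | h
  · left; linarith
  · right; linarith

lemma inV_tr {u v : V} {x : Pt} : L.tr.InV u v x.swap ↔ L.InH u v x := by
  simp only [InV, InH, tr, Prod.fst_swap, Prod.snd_swap]; tauto

/-- Exits lie on the boundary of the box, and are of six kinds. -/
lemma ex_boundary {u v w : V} {Q : Pt} (h : L.Ex u v w Q) :
    (L.b w ≤ Q.1 ∧ Q.1 ≤ L.b w + 8 ∧ L.b w ≤ Q.2 ∧ Q.2 ≤ L.b w + 8) ∧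
    (Q.1 = L.b w ∨ Q.1 = L.b w + 8 ∨ Q.2 = L.b w ∨ Q.2 = L.b w + 8) := by
  rcases h with ⟨rfl, h⟩ | ⟨rfl, h⟩ <;> rcases h with ⟨h, rfl⟩ | ⟨h, rfl⟩ | ⟨h, rfl⟩
  · have := L.ab _ _ h; refine ⟨⟨?_, ?_, ?_, ?_⟩, ?_⟩ <;> simp <;> linarith
  · have := L.be _ _ h; refine ⟨⟨?_, ?_, ?_, ?_⟩, ?_⟩ <;> simp <;> linarith
  · refine ⟨⟨?_, ?_, ?_, ?_⟩, ?_⟩ <;> simp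
  · have := L.ab _ _ h; refine ⟨⟨?_, ?_, ?_, ?_⟩, ?_⟩ <;> simp <;> linarith
  · have := L.be _ _ h; refine ⟨⟨?_, ?_, ?_, ?_⟩, ?_⟩ <;> simp <;> linarith
  · refine ⟨⟨?_, ?_, ?_, ?_⟩, ?_⟩ <;> simp

lemma ex_inj {u v u' v' w : V} {Q : Pt} (h : L.Ex u v w Q) (h' : L.Ex u' v' w Q) :
    u = u' ∧ v = v' := by
  rcases h with ⟨rfl, h⟩ | ⟨rfl, h⟩ <;> rcases h' with ⟨rfl, h'⟩ | ⟨rfl, h'⟩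
  · refine ⟨rfl, ?_⟩
    by_contra hne
    have hc := L.ne_cases hne
    rcases h with ⟨h, rfl⟩ | ⟨h, rfl⟩ | ⟨h, rfl⟩ <;>
      rcases h' with ⟨h', hQ⟩ | ⟨h', hQ⟩ | ⟨h', hQ⟩ <;> rw [Prod.mk.injEq] at hQ
    · rcases hc with hc | hc
      · have := L.abc _ _ _ h h' hc; linarith
      · have := L.abc _ _ _ h' h hc; linarith
    · have := L.ab _ _ h; have := L.be _ _ h'; linarith
    · have := L.ab _ _ h; linarith
    · have := L.be _ _ h; have := L.ab _ _ h'; linarith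
    · rcases hc with hc | hc
      · have := L.ber _ _ _ h h' hc; linarith
      · have := L.ber _ _ _ h' h hc; linarith
    · have := L.be _ _ h; linarith
    · have := L.ab _ _ h'; linarith
    · have := L.be _ _ h'; linarith
    · have := L.fr _ _ h; have := L.fr _ _ h'; rcases hc with hc | hc <;> linarith
  · exfalso
    rcases h with ⟨h, rfl⟩ | ⟨h, rfl⟩ | ⟨h, rfl⟩ <;>
      rcases h' with ⟨h', hQ⟩ | ⟨h', hQ⟩ | ⟨h', hQ⟩ <;> rw [Prod.mk.injEq] at hQ <;>
      first
        | linarith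
        | (have := L.ab _ _ h; linarith)
        | (have := L.be _ _ h; linarith)
        | (have := L.ab _ _ h'; linarith)
        | (have := L.be _ _ h'; linarith)
  · exfalso
    rcases h with ⟨h, rfl⟩ | ⟨h, rfl⟩ | ⟨h, rfl⟩ <;>
      rcases h' with ⟨h', hQ⟩ | ⟨h', hQ⟩ | ⟨h', hQ⟩ <;> rw [Prod.mk.injEq] at hQ <;>
      first
        | linarith
        | (have := L.ab _ _ h; linarith)
        | (have := L.be _ _ h; linarith)
        | (have := L.ab _ _ h'; linarith)
        | (have := L.be _ _ h'; linarith)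
  · refine ⟨?_, rfl⟩
    by_contra hne
    have hc := L.ne_cases hne
    rcases h with ⟨h, rfl⟩ | ⟨h, rfl⟩ | ⟨h, rfl⟩ <;>
      rcases h' with ⟨h', hQ⟩ | ⟨h', hQ⟩ | ⟨h', hQ⟩ <;> rw [Prod.mk.injEq] at hQ
    · rcases hc with hc | hc
      · have := L.abr _ _ _ h h' hc; linarith
      · have := L.abr _ _ _ h' h hc; linarith
    · have := L.ab _ _ h; have := L.be _ _ h'; linarith
    · have := L.ab _ _ h; linarith
    · have := L.be _ _ h; have := L.ab _ _ h'; linarith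
    · rcases hc with hc | hc
      · have := L.bec _ _ _ h h' hc; linarith
      · have := L.bec _ _ _ h' h hc; linarith
    · have := L.be _ _ h; linarith
    · have := L.ab _ _ h'; linarith
    · have := L.be _ _ h'; linarith
    · have := L.fr _ _ h; have := L.fr _ _ h'; rcases hc with hc | hc <;> linarith

end Lay

lemma seg_coord {P Q x : Pt} (h : x ∈ segment ℝ P Q) : ∃ t : ℝ, 0 ≤ t ∧ t ≤ 1 ∧
    x.1 = P.1 + t * (Q.1 - P.1) ∧ x.2 = P.2 + t * (Q.2 - P.2) := by
  rw [segment_eq_image] at h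
  obtain ⟨t, ht, rfl⟩ := h
  refine ⟨t, ht.1, ht.2, ?_, ?_⟩ <;> simp <;> ring

/-- a point of a segment from an interior point of a box to a point of the box -/
lemma box_open {b : ℝ} {P Q x : Pt} (h : x ∈ segment ℝ P Q)
    (hP : (b < P.1 ∧ P.1 < b + 8) ∧ (b < P.2 ∧ P.2 < b + 8))
    (hQ : b ≤ Q.1 ∧ Q.1 ≤ b + 8 ∧ b ≤ Q.2 ∧ Q.2 ≤ b + 8) :
    x = Q ∨ ((b < x.1 ∧ x.1 < b + 8) ∧ (b < x.2 ∧ x.2 < b + 8)) := by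
  obtain ⟨t, h0, h1, e1, e2⟩ := seg_coord h
  rcases h1.lt_or_eq with h1 | rfl
  · right
    obtain ⟨⟨p1, p2⟩, p3, p4⟩ := hP
    obtain ⟨q1, q2, q3, q4⟩ := hQ
    refine ⟨⟨?_, ?_⟩, ?_, ?_⟩
    · rw [e1]; nlinarith
    · rw [e1]; nlinarith
    · rw [e2]; nlinarith
    · rw [e2]; nlinarith
  · left; ext <;> simp [e1, e2]

lemma star_aux {b : ℝ} {P Q Q' x : Pt} {t t' : ℝ}
    (hP : (b < P.1 ∧ P.1 < b + 8) ∧ (b < P.2 ∧ P.2 < b + 8))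
    (hQ : b ≤ Q.1 ∧ Q.1 ≤ b + 8 ∧ b ≤ Q.2 ∧ Q.2 ≤ b + 8)
    (hQ' : Q'.1 = b ∨ Q'.1 = b + 8 ∨ Q'.2 = b ∨ Q'.2 = b + 8)
    (h0 : 0 ≤ t) (htt : t < t')
    (e1 : x.1 = P.1 + t * (Q.1 - P.1)) (e2 : x.2 = P.2 + t * (Q.2 - P.2))
    (e1' : x.1 = P.1 + t' * (Q'.1 - P.1)) (e2' : x.2 = P.2 + t' * (Q'.2 - P.2)) : False := by
  obtain ⟨⟨p1, p2⟩, p3, p4⟩ := hP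
  obtain ⟨q1, q2, q3, q4⟩ := hQ
  rcases hQ' with h | h | h | h
  · rw [h] at e1'
    nlinarith [mul_nonneg h0 (sub_nonneg.2 q1), mul_pos (sub_pos.2 htt) (sub_pos.2 p1)]
  · rw [h] at e1'
    nlinarith [mul_nonneg h0 (sub_nonneg.2 q2), mul_pos (sub_pos.2 htt) (sub_pos.2 p2)]
  · rw [h] at e2'
    nlinarith [mul_nonneg h0 (sub_nonneg.2 q3), mul_pos (sub_pos.2 htt) (sub_pos.2 p3)]
  · rw [h] at e2'
    nlinarith [mul_nonneg h0 (sub_nonneg.2 q4), mul_pos (sub_pos.2 htt) (sub_pos.2 p4)]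

lemma star {b : ℝ} {P Q Q' x : Pt} (h : x ∈ segment ℝ P Q) (h' : x ∈ segment ℝ P Q')
    (hP : (b < P.1 ∧ P.1 < b + 8) ∧ (b < P.2 ∧ P.2 < b + 8))
    (hQ : (b ≤ Q.1 ∧ Q.1 ≤ b + 8 ∧ b ≤ Q.2 ∧ Q.2 ≤ b + 8) ∧
      (Q.1 = b ∨ Q.1 = b + 8 ∨ Q.2 = b ∨ Q.2 = b + 8))
    (hQ' : (b ≤ Q'.1 ∧ Q'.1 ≤ b + 8 ∧ b ≤ Q'.2 ∧ Q'.2 ≤ b + 8) ∧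
      (Q'.1 = b ∨ Q'.1 = b + 8 ∨ Q'.2 = b ∨ Q'.2 = b + 8))
    (hne : Q ≠ Q') : x = P := by
  obtain ⟨t, h0, h1, e1, e2⟩ := seg_coord h
  obtain ⟨t', h0', h1', e1', e2'⟩ := seg_coord h'
  rcases lt_trichotomy t t' with htt | htt | htt
  · exact (star_aux hP hQ.1 hQ'.2 h0 htt e1 e2 e1' e2').elim
  · subst htt
    rcases h0.lt_or_eq with ht | rfl
    · exfalso
      apply hne
      have a1 : t * (Q.1 - P.1) = t * (Q'.1 - P.1) := by linarith
      have a2 : t * (Q.2 - P.2) = t * (Q'.2 - P.2) := by linarith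
      have b1 := mul_left_cancel₀ ht.ne' a1
      have b2 := mul_left_cancel₀ ht.ne' a2
      ext <;> linarith
    · ext <;> simp [e1, e2]
  · exact (star_aux hP hQ'.1 hQ.2 h0' htt e1' e2' e1 e2).elim

namespace Lay

variable {V : Type} {L : Lay V}

lemma p_in (w : V) : (L.b w < (L.p w).1 ∧ (L.p w).1 < L.b w + 8) ∧
    (L.b w < (L.p w).2 ∧ (L.p w).2 < L.b w + 8) := ⟨L.hX w, L.hY w⟩

lemma corner_ex {u v w : V} {Q : Pt} (h : L.Ex u v w Q) :
    (Q = (L.b w + 8, L.b w + 8) → w = u ∧ L.Fr u v) ∧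
    (Q = (L.b w, L.b w) → w = v ∧ L.Fr u v) := by
  rcases h with ⟨rfl, h⟩ | ⟨rfl, h⟩ <;> rcases h with ⟨h, rfl⟩ | ⟨h, rfl⟩ | ⟨h, rfl⟩
  · have := L.ab _ _ h
    constructor <;> intro hQ <;> rw [Prod.mk.injEq] at hQ <;> exfalso <;> linarith
  · have := L.be _ _ h
    constructor <;> intro hQ <;> rw [Prod.mk.injEq] at hQ <;> exfalso <;> linarith
  · constructor <;> intro hQ
    · exact ⟨rfl, h⟩
    · rw [Prod.mk.injEq] at hQ; exfalso; linarith
  · have := L.ab _ _ h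
    constructor <;> intro hQ <;> rw [Prod.mk.injEq] at hQ <;> exfalso <;> linarith
  · have := L.be _ _ h
    constructor <;> intro hQ <;> rw [Prod.mk.injEq] at hQ <;> exfalso <;> linarith
  · constructor <;> intro hQ
    · rw [Prod.mk.injEq] at hQ; exfalso; linarith
    · exact ⟨rfl, h⟩

lemma ex_mem {u v w : V} {Q : Pt} (h : L.Ex u v w Q) : w = u ∨ w = v := by
  rcases h with ⟨rfl, h⟩ | ⟨rfl, h⟩ <;> simp

lemma loc_loc_aux {u v u' v' w w' : V} {Q Q' x : Pt} (h : L.Ex u v w Q) (h' : L.Ex u' v' w' Q')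
    (hx : x ∈ segment ℝ (L.p w) Q) (hx' : x ∈ segment ℝ (L.p w') Q') (hb : L.b w + 8 ≤ L.b w') :
    u = u' ∧ v = v' := by
  have hQ := ex_boundary h
  have hQ' := ex_boundary h'
  have o := box_open hx (p_in w) hQ.1
  have o' := box_open hx' (p_in w') hQ'.1
  have k : (L.b w ≤ x.1 ∧ x.1 ≤ L.b w + 8 ∧ L.b w ≤ x.2 ∧ x.2 ≤ L.b w + 8) := by
    rcases o with rfl | o
    · exact hQ.1
    · refine ⟨?_, ?_, ?_, ?_⟩ <;> linarith
  have k' : (L.b w' ≤ x.1 ∧ x.1 ≤ L.b w' + 8 ∧ L.b w' ≤ x.2 ∧ x.2 ≤ L.b w' + 8) := by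
    rcases o' with rfl | o'
    · exact hQ'.1
    · refine ⟨?_, ?_, ?_, ?_⟩ <;> linarith
  have e1 : x = Q := by rcases o with o | o; exact o; exfalso; linarith
  have e2 : x = Q' := by rcases o' with o | o; exact o; exfalso; linarith
  have e3 : x = (L.b w + 8, L.b w + 8) := by ext <;> simp <;> linarith
  have e4 : x = (L.b w', L.b w') := by ext <;> simp <;> linarith
  obtain ⟨rfl, f1⟩ := (corner_ex h).1 (e1.symm.trans e3)
  obtain ⟨rfl, f2⟩ := (corner_ex h').2 (e2.symm.trans e4)
  have g1 := L.fr _ _ f1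
  have g2 := L.fr _ _ f2
  constructor
  · apply b_inj (L := L); linarith
  · apply b_inj (L := L); linarith

lemma loc_loc {u v u' v' : V} {x : Pt} (hne : ¬ (u = u' ∧ v = v')) (h : L.InLoc u v x)
    (h' : L.InLoc u' v' x) : ∃ w, (w = u ∨ w = v) ∧ (w = u' ∨ w = v') ∧ x = L.p w := by
  obtain ⟨w, Q, h, hx⟩ := h
  obtain ⟨w', Q', h', hx'⟩ := h'
  by_cases hw : w = w'
  · subst hw
    refine ⟨w, ex_mem h, ex_mem h', ?_⟩
    refine star hx hx' (p_in w) (ex_boundary h) (ex_boundary h') ?_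
    rintro rfl
    exact hne (ex_inj h h')
  · exfalso
    rcases L.sep w w' hw with hb | hb
    · exact hne (loc_loc_aux h h' hx hx' hb)
    · have := loc_loc_aux h' h hx' hx hb
      exact hne ⟨this.1.symm, this.2.symm⟩

/-- columns determine edges -/
lemma V_V {u v u' v' : V} {x : Pt} (h : L.InV u v x) (h' : L.InV u' v' x) : u = u' ∧ v = v' := by
  rcases h with ⟨h, hx, h1, h2⟩ | ⟨h, hx, h1, h2⟩ <;>
    rcases h' with ⟨h', hx', h1', h2'⟩ | ⟨h', hx', h1', h2'⟩
  · have a := L.ab _ _ h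
    have a' := L.ab _ _ h'
    obtain rfl : u = u' := slot (t := x.1) (L := L) (by linarith) (by linarith) (by linarith) (by linarith)
    refine ⟨rfl, ?_⟩
    by_contra hne
    rcases L.ne_cases hne with hc | hc
    · have := L.abc _ _ _ h h' hc; linarith
    · have := L.abc _ _ _ h' h hc; linarith
  · have a := L.ab _ _ h
    have a' := L.be _ _ h'
    obtain rfl : u = v' := slot (t := x.1) (L := L) (by linarith) (by linarith) (by linarith) (by linarith)
    exfalso; linarith
  · have a := L.be _ _ h
    have a' := L.ab _ _ h'
    obtain rfl : v = u' := slot (t := x.1) (L := L) (by linarith) (by linarith) (by linarith) (by linarith)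
    exfalso; linarith
  · have a := L.be _ _ h
    have a' := L.be _ _ h'
    obtain rfl : v = v' := slot (t := x.1) (L := L) (by linarith) (by linarith) (by linarith) (by linarith)
    refine ⟨?_, rfl⟩
    by_contra hne
    rcases L.ne_cases hne with hc | hc
    · have := L.bec _ _ _ h h' hc; linarith
    · have := L.bec _ _ _ h' h hc; linarith

lemma H_H {u v u' v' : V} {x : Pt} (h : L.InH u v x) (h' : L.InH u' v' x) : u = u' ∧ v = v' :=
  V_V (inV_tr.2 h) (inV_tr.2 h')

lemma V_off {u v w : V} {x : Pt} (h : L.InV u v x) (h1 : L.b w < x.1) (h2 : x.1 < L.b w + 8) :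
    (w = u ∨ w = v) ∧ ¬ (L.b w < x.2 ∧ x.2 < L.b w + 8) := by
  rcases h with ⟨h, hx, h3, h4⟩ | ⟨h, hx, h3, h4⟩
  · have a := L.ab _ _ h
    obtain rfl : u = w := slot (t := x.1) (L := L) (by linarith) (by linarith) (by linarith) (by linarith)
    exact ⟨Or.inl rfl, fun h => by linarith⟩
  · have a := L.be _ _ h
    obtain rfl : v = w := slot (t := x.1) (L := L) (by linarith) (by linarith) (by linarith) (by linarith)
    exact ⟨Or.inr rfl, fun h => by linarith⟩

lemma V_bd {u v w : V} {x : Pt} (h : L.InV u v x) : x.1 ≠ L.b w ∧ x.1 ≠ L.b w + 8 := by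
  have key : ∀ z, L.b z < x.1 → x.1 < L.b z + 8 → x.1 ≠ L.b w ∧ x.1 ≠ L.b w + 8 := by
    intro z h1 h2
    by_cases hz : z = w
    · subst hz; constructor <;> intro h <;> linarith
    · rcases L.sep z w hz with h | h
      · constructor <;> intro h <;> linarith
      · constructor <;> intro h <;> linarith
  rcases h with ⟨h, hx, h3, h4⟩ | ⟨h, hx, h3, h4⟩
  · have a := L.ab _ _ h
    exact key u (by linarith) (by linarith)
  · have a := L.be _ _ h
    exact key v (by linarith) (by linarith)

lemma loc_V {u v u' v' : V} {x : Pt} (h : L.InLoc u v x) (h' : L.InV u' v' x) :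
    u = u' ∧ v = v' := by
  obtain ⟨w, Q, h, hx⟩ := h
  rcases box_open hx (p_in w) (ex_boundary h).1 with rfl | o
  · have hbd := V_bd (w := w) h'
    rcases h with ⟨rfl, h⟩ | ⟨rfl, h⟩ <;> rcases h with ⟨h, rfl⟩ | ⟨h, rfl⟩ | ⟨h, rfl⟩
    · have a := L.ab _ _ h
      exact V_V (Or.inl ⟨h, rfl, le_rfl, by simp; linarith⟩) h'
    · exact absurd rfl hbd.2
    · exact absurd rfl hbd.2
    · exact absurd rfl hbd.1
    · have a := L.be _ _ h
      exact V_V (Or.inr ⟨h, rfl, by simp; linarith, le_rfl⟩) h'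
    · exact absurd rfl hbd.1
  · exact absurd o.2 (V_off h' o.1.1 o.1.2).2

lemma ex_tr {u v w : V} {Q : Pt} (h : L.Ex u v w Q) : L.tr.Ex u v w Q.swap := by
  rcases h with ⟨rfl, h⟩ | ⟨rfl, h⟩ <;> rcases h with ⟨h, rfl⟩ | ⟨h, rfl⟩ | ⟨h, rfl⟩
  · exact Or.inl ⟨rfl, Or.inr (Or.inl ⟨h, rfl⟩)⟩
  · exact Or.inl ⟨rfl, Or.inl ⟨h, rfl⟩⟩
  · exact Or.inl ⟨rfl, Or.inr (Or.inr ⟨h, rfl⟩)⟩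
  · exact Or.inr ⟨rfl, Or.inr (Or.inl ⟨h, rfl⟩)⟩
  · exact Or.inr ⟨rfl, Or.inl ⟨h, rfl⟩⟩
  · exact Or.inr ⟨rfl, Or.inr (Or.inr ⟨h, rfl⟩)⟩

lemma loc_tr {u v : V} {x : Pt} (h : L.InLoc u v x) : L.tr.InLoc u v x.swap := by
  obtain ⟨w, Q, h, hx⟩ := h
  refine ⟨w, Q.swap, ex_tr h, ?_⟩
  rw [segment_eq_image] at hx ⊢
  obtain ⟨t, ht, rfl⟩ := hx
  exact ⟨t, ht, by ext <;> simp [p, tr]⟩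

lemma loc_H {u v u' v' : V} {x : Pt} (h : L.InLoc u v x) (h' : L.InH u' v' x) :
    u = u' ∧ v = v' := loc_V (loc_tr h) (inV_tr.2 h')

lemma V_H_ab {u v u' v' : V} {x : Pt} (hne : ¬ (u = u' ∧ v = v')) (h : L.Ab u v)
    (hx : x.1 = L.c u v) (h1 : L.b u + 8 ≤ x.2) (h2 : x.2 ≤ L.r u v) (h' : L.InH u' v' x) :
    u ≠ u' ∧ u ≠ v' ∧ v ≠ u' ∧ v ≠ v' := by
  have a := L.ab _ _ h
  rcases h' with ⟨h', hx', h1', h2'⟩ | ⟨h', hx', h1', h2'⟩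
  · have a' := L.ab _ _ h'
    refine ⟨?_, ?_, ?_, ?_⟩
    · rintro rfl
      have hv : v ≠ v' := fun h => hne ⟨rfl, h⟩
      rcases L.sep _ _ hv with hc | hc
      · linarith
      · have := L.abc _ _ _ h' h (by linarith); linarith
    · rintro rfl; linarith
    · rintro rfl; linarith
    · rintro rfl
      have hu : u ≠ u' := fun h => hne ⟨h, rfl⟩
      rcases L.sep _ _ hu with hc | hc
      · linarith
      · have := L.abr _ _ _ h' h (by linarith); linarith
  · have a' := L.be _ _ h'
    refine ⟨?_, ?_, ?_, ?_⟩
    · rintro rfl; linarith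
    · rintro rfl; linarith
    · rintro rfl; linarith
    · rintro rfl; 
      have hu : u ≠ u' := by rintro rfl; linarith
      rcases L.sep _ _ hu with hc | hc
      · linarith
      · linarith

lemma V_H_be {u v u' v' : V} {x : Pt} (hne : ¬ (u = u' ∧ v = v')) (h : L.Be u v)
    (hx : x.1 = L.c u v) (h1 : L.r u v ≤ x.2) (h2 : x.2 ≤ L.b v) (h' : L.InH u' v' x) :
    u ≠ u' ∧ u ≠ v' ∧ v ≠ u' ∧ v ≠ v' := by
  have a := L.be _ _ h
  rcases h' with ⟨h', hx', h1', h2'⟩ | ⟨h', hx', h1', h2'⟩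
  · have a' := L.ab _ _ h'
    refine ⟨?_, ?_, ?_, ?_⟩
    · rintro rfl
      have hv : v ≠ v' := by rintro rfl; linarith
      rcases L.sep _ _ hv with hc | hc
      · linarith
      · linarith
    · rintro rfl; linarith
    · rintro rfl; linarith
    · rintro rfl; linarith
  · have a' := L.be _ _ h'
    refine ⟨?_, ?_, ?_, ?_⟩
    · rintro rfl
      have hv : v ≠ v' := fun h => hne ⟨rfl, h⟩
      rcases L.sep _ _ hv with hc | hc
      · have := L.ber _ _ _ h h' (by linarith); linarith
      · linarith
    · rintro rfl; linarith
    · rintro rfl; linarith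
    · rintro rfl
      have hu : u ≠ u' := fun h => hne ⟨h, rfl⟩
      rcases L.sep _ _ hu with hc | hc
      · have := L.bec _ _ _ h h' (by linarith); linarith
      · linarith

lemma V_H {u v u' v' : V} {x : Pt} (hne : ¬ (u = u' ∧ v = v')) (h : L.InV u v x)
    (h' : L.InH u' v' x) : u ≠ u' ∧ u ≠ v' ∧ v ≠ u' ∧ v ≠ v' := by
  rcases h with ⟨h, hx, h1, h2⟩ | ⟨h, hx, h1, h2⟩
  · exact V_H_ab hne h hx h1 h2 h'
  · exact V_H_be hne h hx h1 h2 h'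

end Lay

lemma mem_seg_x {a y0 y1 : ℝ} {x : Pt} (h : x.1 = a) (h0 : y0 ≤ x.2) (h1 : x.2 ≤ y1) :
    x ∈ segment ℝ ((a, y0) : Pt) (a, y1) := by
  rcases eq_or_lt_of_le (h0.trans h1) with h2 | h2
  · subst h2
    have : x = (a, y0) := by ext <;> simp <;> linarith
    rw [this]; exact left_mem_segment _ _ _
  · rw [segment_eq_image]
    refine ⟨(x.2 - y0) / (y1 - y0), ⟨?_, ?_⟩, ?_⟩
    · exact div_nonneg (by linarith) (by linarith)
    · rw [div_le_one (by linarith)]; linarith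
    · have : y1 - y0 ≠ 0 := by linarith
      ext
      · simp [h]; ring
      · simp; field_simp; ring

lemma mem_seg_y {a y0 y1 : ℝ} {x : Pt} (h : x.2 = a) (h0 : y0 ≤ x.1) (h1 : x.1 ≤ y1) :
    x ∈ segment ℝ ((y0, a) : Pt) (y1, a) := by
  have := mem_seg_x (x := x.swap) (a := a) (y0 := y0) (y1 := y1) h h0 h1
  rw [segment_eq_image] at this ⊢
  obtain ⟨t, ht, hx⟩ := this
  refine ⟨t, ht, ?_⟩
  rw [Prod.ext_iff] at hx ⊢
  simp at hx ⊢
  exact ⟨hx.2, hx.1⟩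

lemma seg_x {a y0 y1 : ℝ} {x : Pt} (hle : y0 ≤ y1) (h : x ∈ segment ℝ ((a, y0) : Pt) (a, y1)) :
    x.1 = a ∧ y0 ≤ x.2 ∧ x.2 ≤ y1 := by
  obtain ⟨t, h0, h1, e1, e2⟩ := seg_coord h
  simp only at e1 e2
  refine ⟨by rw [e1]; ring, ?_, ?_⟩ <;> rw [e2] <;> nlinarith

lemma seg_y {a y0 y1 : ℝ} {x : Pt} (hle : y0 ≤ y1) (h : x ∈ segment ℝ ((y0, a) : Pt) (y1, a)) :
    x.2 = a ∧ y0 ≤ x.1 ∧ x.1 ≤ y1 := by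
  obtain ⟨t, h0, h1, e1, e2⟩ := seg_coord h
  simp only at e1 e2
  refine ⟨by rw [e2]; ring, ?_, ?_⟩ <;> rw [e1] <;> nlinarith

namespace Lay

variable {V : Type} (L : Lay V)

def IsPoly (u v : V) (l : List Pt) : Prop :=
  (L.Ab u v ∧ L.c u v = L.X u ∧ l = [L.p u, (L.c u v, L.r u v), (L.b v, L.r u v), L.p v]) ∨
  (L.Ab u v ∧ L.r u v = L.Y v ∧ l = [L.p u, (L.c u v, L.b u + 8), (L.c u v, L.r u v), L.p v]) ∨
  (L.Be u v ∧ L.r u v = L.Y u ∧ l = [L.p u, (L.c u v, L.r u v), (L.c u v, L.b v), L.p v]) ∨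
  (L.Be u v ∧ L.c u v = L.X v ∧ l = [L.p u, (L.b u + 8, L.r u v), (L.c u v, L.r u v), L.p v]) ∨
  (L.Fr u v ∧ l = [L.p u, (L.b v, L.b v), L.p v])

variable {L}

lemma seg_class {u v : V} {l : List Pt} (h : L.IsPoly u v l) {s : Pt × Pt} (hs : s ∈ polySegs l)
    {x : Pt} (hx : x ∈ segment ℝ s.1 s.2) :
    L.InLoc u v x ∨ (L.InV u v x ∧ s.1.1 = s.2.1) ∨ (L.InH u v x ∧ s.1.2 = s.2.2) := by
  have hXu := L.hX u
  have hXv := L.hX v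
  have hYu := L.hY u
  have hYv := L.hY v
  rcases h with ⟨h, hp, rfl⟩ | ⟨h, hp, rfl⟩ | ⟨h, hp, rfl⟩ | ⟨h, hp, rfl⟩ | ⟨h, rfl⟩ <;>
    simp only [polySegs, List.tail_cons, List.zip_cons_cons, List.zip_nil_right, List.mem_cons,
      List.not_mem_nil, or_false] at hs
  · have a := L.ab _ _ h
    rcases hs with rfl | rfl | rfl
    · simp only [p, hp] at hx
      have hx' := seg_x (by linarith) hx
      by_cases hy : x.2 ≤ L.b u + 8
      · left
        refine ⟨u, _, Or.inl ⟨rfl, Or.inl ⟨h, rfl⟩⟩, ?_⟩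
        rw [hp]; exact mem_seg_x hx'.1 hx'.2.1 hy
      · right; left
        exact ⟨Or.inl ⟨h, by rw [hp]; exact hx'.1, by linarith, hx'.2.2⟩, hp.symm⟩
    · right; right
      have hx' := seg_y (by linarith) hx
      exact ⟨Or.inl ⟨h, hx'.1, hx'.2.1, hx'.2.2⟩, rfl⟩
    · left
      refine ⟨v, _, Or.inr ⟨rfl, Or.inl ⟨h, rfl⟩⟩, ?_⟩
      rw [segment_symm]; exact hx
  · have a := L.ab _ _ h
    rcases hs with rfl | rfl | rfl
    · left
      exact ⟨u, _, Or.inl ⟨rfl, Or.inl ⟨h, rfl⟩⟩, hx⟩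
    · right; left
      have hx' := seg_x (by linarith) hx
      exact ⟨Or.inl ⟨h, hx'.1, hx'.2.1, hx'.2.2⟩, rfl⟩
    · simp only [p, hp] at hx
      have hx' := seg_y (by linarith) hx
      by_cases hy : x.1 ≤ L.b v
      · right; right
        exact ⟨Or.inl ⟨h, by rw [hp]; exact hx'.1, hx'.2.1, hy⟩, hp⟩
      · left
        refine ⟨v, _, Or.inr ⟨rfl, Or.inl ⟨h, rfl⟩⟩, ?_⟩
        rw [segment_symm, hp]; exact mem_seg_y hx'.1 (by linarith) hx'.2.2
  · have a := L.be _ _ h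
    rcases hs with rfl | rfl | rfl
    · simp only [p, hp] at hx
      have hx' := seg_y (by linarith) hx
      by_cases hy : x.1 ≤ L.b u + 8
      · left
        refine ⟨u, _, Or.inl ⟨rfl, Or.inr (Or.inl ⟨h, rfl⟩)⟩, ?_⟩
        rw [hp]; exact mem_seg_y hx'.1 hx'.2.1 hy
      · right; right
        exact ⟨Or.inr ⟨h, by rw [hp]; exact hx'.1, by linarith, hx'.2.2⟩, hp.symm⟩
    · right; left
      have hx' := seg_x (by linarith) hx
      exact ⟨Or.inr ⟨h, hx'.1, hx'.2.1, hx'.2.2⟩, rfl⟩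
    · left
      refine ⟨v, _, Or.inr ⟨rfl, Or.inr (Or.inl ⟨h, rfl⟩)⟩, ?_⟩
      rw [segment_symm]; exact hx
  · have a := L.be _ _ h
    rcases hs with rfl | rfl | rfl
    · left
      exact ⟨u, _, Or.inl ⟨rfl, Or.inr (Or.inl ⟨h, rfl⟩)⟩, hx⟩
    · right; right
      have hx' := seg_y (by linarith) hx
      exact ⟨Or.inr ⟨h, hx'.1, hx'.2.1, hx'.2.2⟩, rfl⟩
    · simp only [p, hp] at hx
      have hx' := seg_x (by linarith) hx
      by_cases hy : x.2 ≤ L.b v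
      · right; left
        exact ⟨Or.inr ⟨h, by rw [hp]; exact hx'.1, hx'.2.1, hy⟩, hp⟩
      · left
        refine ⟨v, _, Or.inr ⟨rfl, Or.inr (Or.inl ⟨h, rfl⟩)⟩, ?_⟩
        rw [segment_symm, hp]; exact mem_seg_x hx'.1 (by linarith) hx'.2.2
  · have a := L.fr _ _ h
    rcases hs with rfl | rfl
    · left
      refine ⟨u, _, Or.inl ⟨rfl, Or.inr (Or.inr ⟨h, rfl⟩)⟩, ?_⟩
      rw [← a]; exact hx
    · left
      refine ⟨v, _, Or.inr ⟨rfl, Or.inr (Or.inr ⟨h, rfl⟩)⟩, ?_⟩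
      rw [segment_symm]; exact hx

lemma poly_class {u v : V} {l : List Pt} (h : L.IsPoly u v l) {x : Pt} (hx : x ∈ polySet l) :
    L.InLoc u v x ∨ L.InV u v x ∨ L.InH u v x := by
  simp only [polySet, Set.mem_iUnion] at hx
  obtain ⟨s, hs, hx⟩ := hx
  rcases seg_class h hs hx with h | h | h
  · exact Or.inl h
  · exact Or.inr (Or.inl h.1)
  · exact Or.inr (Or.inr h.1)

/-- the vertex point `p w` only lies on edges at `w` -/
lemma vertex_only {u v w : V} (h : L.InLoc u v (L.p w) ∨ L.InV u v (L.p w) ∨ L.InH u v (L.p w)) :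
    w = u ∨ w = v := by
  have hp := p_in (L := L) w
  rcases h with h | h | h
  · obtain ⟨w', Q, h, hx⟩ := h
    have hm := ex_mem h
    suffices w = w' by rw [this]; exact hm
    by_contra hne
    have hQ := (ex_boundary h).1
    have k : (L.b w' ≤ (L.p w).1 ∧ (L.p w).1 ≤ L.b w' + 8) := by
      rcases box_open hx (p_in w') hQ with o | o
      · rw [o]; exact ⟨hQ.1, hQ.2.1⟩
      · constructor <;> linarith
    rcases L.sep _ _ hne with hc | hc <;> linarith
  · exact (V_off h hp.1.1 hp.1.2).1
  · exact (V_off (w := w) (inV_tr.2 h) hp.2.1 hp.2.2).1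

/-- the core statement about two different edges -/
lemma core {u v u' v' : V} {x : Pt} (hne : ¬ (u = u' ∧ v = v'))
    (h : L.InLoc u v x ∨ L.InV u v x ∨ L.InH u v x)
    (h' : L.InLoc u' v' x ∨ L.InV u' v' x ∨ L.InH u' v' x) :
    (∃ w, (w = u ∨ w = v) ∧ (w = u' ∨ w = v') ∧ x = L.p w) ∨
    ((u ≠ u' ∧ u ≠ v' ∧ v ≠ u' ∧ v ≠ v') ∧
      ((L.InV u v x ∧ L.InH u' v' x) ∨ (L.InH u v x ∧ L.InV u' v' x))) := by
  have hne' : ¬ (u' = u ∧ v' = v) := fun h => hne ⟨h.1.symm, h.2.symm⟩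
  rcases h with h | h | h <;> rcases h' with h' | h' | h'
  · exact Or.inl (loc_loc hne h h')
  · exact absurd (loc_V h h') hne
  · exact absurd (loc_H h h') hne
  · exact absurd (loc_V h' h) hne'
  · exact absurd (V_V h h') hne
  · exact Or.inr ⟨V_H hne h h', Or.inl ⟨h, h'⟩⟩
  · exact absurd (loc_H h' h) hne'
  · have := V_H hne' h' h
    exact Or.inr ⟨⟨this.1.symm, this.2.2.1.symm, this.2.1.symm, this.2.2.2.symm⟩, Or.inr ⟨h, h'⟩⟩
  · exact absurd (H_H h h') hne

lemma inV_col {u v : V} {x : Pt} (h : L.InV u v x) : x.1 = L.c u v := by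
  rcases h with h | h <;> exact h.2.1

lemma inH_row {u v : V} {x : Pt} (h : L.InH u v x) : x.2 = L.r u v := by
  rcases h with h | h <;> exact h.2.1

lemma draw (G : SimpleGraph V) (o : Sym2 V → V × V) (poly : Sym2 V → List Pt)
    (ho : ∀ e ∈ G.edgeSet, e = s((o e).1, (o e).2))
    (hpoly : ∀ e ∈ G.edgeSet, L.IsPoly (o e).1 (o e).2 (poly e)) :
    IsBendRACDrawing 2 G L.p poly := by
  have hmem : ∀ e ∈ G.edgeSet, ∀ w, w ∈ e ↔ (w = (o e).1 ∨ w = (o e).2) := by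
    intro e he w
    conv_lhs => rw [ho e he]
    exact Sym2.mem_iff
  have hneq : ∀ e ∈ G.edgeSet, ∀ e' ∈ G.edgeSet, e ≠ e' →
      ¬ ((o e).1 = (o e').1 ∧ (o e).2 = (o e').2) := by
    intro e he e' he' hne h
    apply hne
    rw [ho e he, ho e' he', h.1, h.2]
  constructor
  · intro a b h
    have ha := p_in (L := L) a
    have hb := p_in (L := L) b
    rw [← h] at hb
    exact slot ha.1.1 ha.1.2 hb.1.1 hb.1.2
  · intro e he
    refine ⟨(o e).1, (o e).2, ho e he, ?_⟩
    rcases hpoly e he with ⟨_, _, h⟩ | ⟨_, _, h⟩ | ⟨_, _, h⟩ | ⟨_, _, h⟩ | ⟨_, h⟩ <;> rw [h] <;> simp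
  · intro e he
    rcases hpoly e he with ⟨_, _, h⟩ | ⟨_, _, h⟩ | ⟨_, _, h⟩ | ⟨_, _, h⟩ | ⟨_, h⟩ <;> rw [h] <;> simp
  · intro e he w hw hp
    exact hw ((hmem e he w).2 (vertex_only (poly_class (hpoly e he) hp)))
  · rintro e he e' he' hne w hw hw' x ⟨hx, hx'⟩
    rcases core (hneq e he e' he' hne) (poly_class (hpoly e he) hx)
      (poly_class (hpoly e' he') hx') with ⟨z, h1, h2, h3⟩ | ⟨h, -⟩
    · rw [← hmem e he] at h1
      rw [← hmem e' he'] at h2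
      by_cases hz : z = w
      · rw [h3, hz]; rfl
      · exfalso
        apply hne
        rw [(Sym2.mem_and_mem_iff hz).1 ⟨h1, hw⟩, (Sym2.mem_and_mem_iff hz).1 ⟨h2, hw'⟩]
    · rw [hmem e he] at hw
      rw [hmem e' he'] at hw'
      exfalso
      rcases hw with hw | hw <;> rcases hw' with hw' | hw' <;> rw [hw] at hw' <;> tauto
  · intro e he e' he' hne
    apply Set.Finite.subset (s := {L.p (o e).1, L.p (o e).2,
      (L.c (o e).1 (o e).2, L.r (o e').1 (o e').2), (L.c (o e').1 (o e').2, L.r (o e).1 (o e).2)})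
    · exact Set.toFinite _
    · rintro x ⟨hx, hx'⟩
      rcases core (hneq e he e' he' hne) (poly_class (hpoly e he) hx)
        (poly_class (hpoly e' he') hx') with ⟨z, h1 | h1, h2, h3⟩ | ⟨-, ⟨h, h'⟩ | ⟨h, h'⟩⟩
      · left; rw [h3, h1]
      · right; left; rw [h3, h1]
      · right; right; left
        ext
        · exact inV_col h
        · exact inH_row h'
      · right; right; right
        ext
        · exact inV_col h'
        · exact inH_row h
  · intro e he e' he' hne s hs s' hs' x hx hx' hw
    have hn := hneq e he e' he' hne
    have hn' := hneq e' he' e he hne.symm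
    have c1 := seg_class (hpoly e he) hs hx
    have c2 := seg_class (hpoly e' he') hs' hx'
    have key : ∀ z, (z = (o e).1 ∨ z = (o e).2) → (z = (o e').1 ∨ z = (o e').2) → x ≠ L.p z :=
      fun z h1 h2 => hw z ((hmem e he z).2 h1) ((hmem e' he' z).2 h2)
    unfold SegOrth
    rcases c1 with h | ⟨h, g⟩ | ⟨h, g⟩ <;> rcases c2 with h' | ⟨h', g'⟩ | ⟨h', g'⟩
    · obtain ⟨z, h1, h2, h3⟩ := loc_loc hn h h'
      exact absurd h3 (key z h1 h2)
    · exact absurd (loc_V h h') hn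
    · exact absurd (loc_H h h') hn
    · exact absurd (loc_V h' h) hn'
    · exact absurd (V_V h h') hn
    · rw [g, g']; ring
    · exact absurd (loc_H h' h) hn'
    · rw [g, g']; ring
    · exact absurd (H_H h h') hn

end Lay

section Fan

variable {V : Type} [Fintype V]

def fdeg (R : V → V → Prop) (u : V) : ℕ := (Finset.univ.filter fun v => R u v).card

def fidx (pos : V → ℕ) (R : V → V → Prop) (u v : V) : ℕ :=
  (Finset.univ.filter fun v' => R u v' ∧ pos v < pos v').card

def fport (pos : V → ℕ) (R P : V → V → Prop) (u : V) : ℕ :=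
  if h : ∃ v, R u v ∧ P u v then fidx pos R u h.choose else 0

lemma fidx_mono {pos : V → ℕ} {R : V → V → Prop} {u v v' : V} (h' : R u v')
    (hp : pos v < pos v') : fidx pos R u v' < fidx pos R u v := by
  apply Finset.card_lt_card
  rw [Finset.ssubset_iff_of_subset]
  · exact ⟨v', by simp [h', hp], by simp⟩
  · intro z; simp only [Finset.mem_filter]; rintro ⟨h1, h2, h3⟩; exact ⟨h1, h2, by omega⟩

lemma fidx_lt {pos : V → ℕ} {R : V → V → Prop} {u v : V} (h : R u v) :
    fidx pos R u v < fdeg R u := by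
  apply Finset.card_lt_card
  rw [Finset.ssubset_iff_of_subset]
  · exact ⟨v, by simp [h], by simp⟩
  · intro z; simp only [Finset.mem_filter]; rintro ⟨h1, h2, h3⟩; exact ⟨h1, h2⟩

lemma fport_lt (pos : V → ℕ) (R P : V → V → Prop) (u : V) :
    fport pos R P u = 0 ∨ fport pos R P u < fdeg R u := by
  unfold fport
  split_ifs with h
  · right; exact fidx_lt h.choose_spec.1
  · left; rfl

lemma fport_eq {pos : V → ℕ} {R P : V → V → Prop} {u v : V} (h : R u v) (hP : P u v)
    (huniq : ∀ v', R u v' → P u v' → v' = v) : fport pos R P u = fidx pos R u v := by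
  unfold fport
  have hex : ∃ v, R u v ∧ P u v := ⟨v, h, hP⟩
  rw [dif_pos hex, huniq _ hex.choose_spec.1 hex.choose_spec.2]

/-- coordinate of a vertex in its slot, from two opposite fans -/
def fpos (pos : V → ℕ) (R P R' P' : V → V → Prop) (u : V) : ℤ :=
  8 * (pos u : ℤ) + 1 + max (fport pos R P u) (fport pos R' P' u)

def fcol (pos : V → ℕ) (R P R' P' : V → V → Prop) (u v : V) : ℤ :=
  fpos pos R P R' P' u + fidx pos R u v - fport pos R P u

lemma fpos_comm (pos : V → ℕ) (R P R' P' : V → V → Prop) (u : V) :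
    fpos pos R P R' P' u = fpos pos R' P' R P u := by
  unfold fpos; rw [max_comm]

lemma fpos_bd {pos : V → ℕ} {R P R' P' : V → V → Prop} {u : V}
    (h7 : fdeg R u + fdeg R' u ≤ 7) :
    8 * (pos u : ℤ) < fpos pos R P R' P' u ∧ fpos pos R P R' P' u < 8 * (pos u : ℤ) + 8 := by
  have h1 := fport_lt pos R P u
  have h2 := fport_lt pos R' P' u
  unfold fpos
  omega

lemma fcol_bd {pos : V → ℕ} {R P R' P' : V → V → Prop} {u v : V} (h : R u v)
    (h7 : fdeg R u + fdeg R' u ≤ 7) :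
    8 * (pos u : ℤ) < fcol pos R P R' P' u v ∧ fcol pos R P R' P' u v < 8 * (pos u : ℤ) + 8 := by
  have h1 := fport_lt pos R P u
  have h2 := fport_lt pos R' P' u
  have h3 := fidx_lt (pos := pos) h
  unfold fcol fpos
  omega

lemma fcol_mono {pos : V → ℕ} {R P R' P' : V → V → Prop} {u v v' : V} (h' : R u v')
    (hp : pos v < pos v') : fcol pos R P R' P' u v' < fcol pos R P R' P' u v := by
  have := fidx_mono (u := u) h' hp
  unfold fcol; omega

lemma fcol_port {pos : V → ℕ} {R P R' P' : V → V → Prop} {u v : V} (h : R u v) (hP : P u v)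
    (huniq : ∀ v', R u v' → P u v' → v' = v) :
    fcol pos R P R' P' u v = fpos pos R P R' P' u := by
  unfold fcol; rw [fport_eq h hP huniq]; ring

lemma fdeg_le {G : SimpleGraph V} (hdeg : ∀ v, (Finset.univ.filter fun z => G.Adj v z).card ≤ 7)
    {R R' : V → V → Prop} {u : V} (h : ∀ v, R u v → G.Adj u v) (h' : ∀ v, R' u v → G.Adj u v)
    (hd : ∀ v, R u v → R' u v → False) : fdeg R u + fdeg R' u ≤ 7 := by
  unfold fdeg
  rw [← Finset.card_union_of_disjoint]
  · refine (Finset.card_le_card ?_).trans (hdeg u)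
    intro z; simp only [Finset.mem_union, Finset.mem_filter, Finset.mem_univ, true_and]
    rintro (hz | hz)
    · exact h z hz
    · exact h' z hz
  · rw [Finset.disjoint_left]; intro z; simp only [Finset.mem_filter]
    rintro ⟨-, h1⟩ ⟨-, h2⟩; exact hd z h1 h2

end Fan

section Concrete

variable {V : Type} [Fintype V] (G : SimpleGraph V) (pos : V → ℕ) (g : V → V → V × Bool × Bool)

def kAb (u v : V) : Prop :=
  G.Adj u v ∧ pos u + 1 < pos v ∧ (g u v = (u, true, false) ∨ g u v = (v, false, false))
def kBe (u v : V) : Prop :=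
  G.Adj u v ∧ pos u + 1 < pos v ∧ (g u v = (u, true, true) ∨ g u v = (v, false, true))
def kAb' (v u : V) : Prop := kAb G pos g u v
def kBe' (v u : V) : Prop := kBe G pos g u v
def pN (u v : V) : Prop := g u v = (u, true, false)
def pE (u v : V) : Prop := g u v = (u, true, true)
def pW (v u : V) : Prop := g u v = (v, false, false)
def pS (v u : V) : Prop := g u v = (v, false, true)

def cX (u : V) : ℤ := fpos pos (kAb G pos g) (pN g) (kBe' G pos g) (pS g) u
def cY (u : V) : ℤ := fpos pos (kAb' G pos g) (pW g) (kBe G pos g) (pE g) u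
def cC (u v : V) : ℤ := if kAb G pos g u v then fcol pos (kAb G pos g) (pN g) (kBe' G pos g) (pS g) u v
  else fcol pos (kBe' G pos g) (pS g) (kAb G pos g) (pN g) v u
def cR (u v : V) : ℤ := if kAb G pos g u v then fcol pos (kAb' G pos g) (pW g) (kBe G pos g) (pE g) v u
  else fcol pos (kBe G pos g) (pE g) (kAb' G pos g) (pW g) u v

variable {G pos g}

lemma not_ab_be {u v : V} (h : kBe G pos g u v) : ¬ kAb G pos g u v := by
  rintro ⟨h1, _, h2⟩
  obtain ⟨_, _, h3⟩ := h
  have hne := h1.ne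
  rcases h2 with h2 | h2 <;> rcases h3 with h3 | h3 <;> rw [h2] at h3 <;> simp at h3

lemma deg_x (hdeg : ∀ v, (Finset.univ.filter fun z => G.Adj v z).card ≤ 7) (u : V) :
    fdeg (kAb G pos g) u + fdeg (kBe' G pos g) u ≤ 7 :=
  fdeg_le hdeg (fun _ h => h.1) (fun _ h => h.1.symm) (fun v h h' => by
    have := h.2.1; have := h'.2.1; omega)

lemma deg_y (hdeg : ∀ v, (Finset.univ.filter fun z => G.Adj v z).card ≤ 7) (u : V) :
    fdeg (kAb' G pos g) u + fdeg (kBe G pos g) u ≤ 7 :=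
  fdeg_le hdeg (fun _ h => h.1.symm) (fun _ h => h.1) (fun v h h' => by
    have := h.2.1; have := h'.2.1; omega)

def lay (hdeg : ∀ v, (Finset.univ.filter fun z => G.Adj v z).card ≤ 7)
    (hinj : Function.Injective pos) : Lay V where
  b v := ((8 * (pos v : ℤ) : ℤ) : ℝ)
  X v := (cX G pos g v : ℝ)
  Y v := (cY G pos g v : ℝ)
  Ab := kAb G pos g
  Be := kBe G pos g
  Fr u v := pos v = pos u + 1
  c u v := (cC G pos g u v : ℝ)
  r u v := (cR G pos g u v : ℝ)
  sep u w h := by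
    have : pos u ≠ pos w := fun h' => h (hinj h')
    norm_cast
    omega
  hX u := by
    have := fpos_bd (pos := pos) (P := pN g) (P' := pS g) (deg_x (pos := pos) (g := g) hdeg u)
    unfold cX
    exact_mod_cast this
  hY u := by
    have := fpos_bd (pos := pos) (P := pW g) (P' := pE g) (deg_y (pos := pos) (g := g) hdeg u)
    unfold cY
    exact_mod_cast this
  ab u v h := by
    have h1 := fcol_bd (pos := pos) (P := pN g) (P' := pS g) h (deg_x (pos := pos) (g := g) hdeg u)
    have h2 := fcol_bd (pos := pos) (R := kAb' G pos g) (P := pW g) (P' := pE g) h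
      (deg_y (pos := pos) (g := g) hdeg v)
    have h3 := h.2.1
    simp only [cC, cR, if_pos h]
    norm_cast
    refine ⟨?_, ?_, ?_, ?_, ?_⟩ <;> omega
  be u v h := by
    have h1 := fcol_bd (pos := pos) (P := pE g) (P' := pW g) h
      ((add_comm _ _).trans_le (deg_y (pos := pos) (g := g) hdeg u))
    have h2 := fcol_bd (pos := pos) (R := kBe' G pos g) (P := pS g) (P' := pN g) h
      ((add_comm _ _).trans_le (deg_x (pos := pos) (g := g) hdeg v))
    have h3 := h.2.1
    simp only [cC, cR, if_neg (not_ab_be h)]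
    norm_cast
    refine ⟨?_, ?_, ?_, ?_, ?_⟩ <;> omega
  fr u v h := by rw [h]; push_cast; ring
  abc u v v' h h' hb := by
    have hp : pos v < pos v' := by
      have : 8 * (pos v : ℤ) < 8 * (pos v' : ℤ) := by exact_mod_cast hb
      omega
    simp only [cC, if_pos h, if_pos h']
    exact_mod_cast fcol_mono h' hp
  abr u v v' h h' hb := by
    have hp : pos u < pos v := by
      have : 8 * (pos u : ℤ) < 8 * (pos v : ℤ) := by exact_mod_cast hb
      omega
    simp only [cR, if_pos h, if_pos h']
    exact_mod_cast fcol_mono (R := kAb' G pos g) h' hp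
  ber u v v' h h' hb := by
    have hp : pos v < pos v' := by
      have : 8 * (pos v : ℤ) < 8 * (pos v' : ℤ) := by exact_mod_cast hb
      omega
    simp only [cR, if_neg (not_ab_be h), if_neg (not_ab_be h')]
    exact_mod_cast fcol_mono h' hp
  bec u v v' h h' hb := by
    have hp : pos u < pos v := by
      have : 8 * (pos u : ℤ) < 8 * (pos v : ℤ) := by exact_mod_cast hb
      omega
    simp only [cC, if_neg (not_ab_be h), if_neg (not_ab_be h')]
    exact_mod_cast fcol_mono (R := kBe' G pos g) h' hp

lemma exists_poly (hdeg : ∀ v, (Finset.univ.filter fun z => G.Adj v z).card ≤ 7)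
    (hinj : Function.Injective pos)
    (h1 : ∀ u v, G.Adj u v → pos u + 1 < pos v →
        (g u v).1 = u ∧ (g u v).2.1 = true ∨ (g u v).1 = v ∧ (g u v).2.1 = false)
    (h2 : ∀ u v u' v', G.Adj u v → pos u + 1 < pos v → G.Adj u' v' → pos u' + 1 < pos v' →
        g u v = g u' v' → u = u' ∧ v = v') {u v : V} (ha : G.Adj u v) (hp : pos u < pos v) :
    ∃ l, (lay (g := g) hdeg hinj).IsPoly u v l := by
  by_cases hf : pos v = pos u + 1
  · exact ⟨_, Or.inr (Or.inr (Or.inr (Or.inr ⟨hf, rfl⟩)))⟩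
  have hp' : pos u + 1 < pos v := by omega
  have hk : g u v = (u, true, false) ∨ g u v = (v, false, false) ∨
      g u v = (u, true, true) ∨ g u v = (v, false, true) := by
    have := h1 u v ha hp'
    rcases hg : g u v with ⟨a, b, c⟩
    rw [hg] at this
    simp only at this
    rcases this with ⟨rfl, rfl⟩ | ⟨rfl, rfl⟩ <;> cases c <;> simp
  rcases hk with hk | hk | hk | hk
  · have hA : kAb G pos g u v := ⟨ha, hp', Or.inl hk⟩
    refine ⟨_, Or.inl ⟨hA, ?_, rfl⟩⟩
    simp only [lay, cC, cX, if_pos hA]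
    norm_cast
    refine fcol_port hA hk ?_
    intro v' hR hP
    exact (h2 u v' u v hR.1 hR.2.1 ha hp' (hP.trans hk.symm)).2
  · have hA : kAb G pos g u v := ⟨ha, hp', Or.inr hk⟩
    refine ⟨_, Or.inr (Or.inl ⟨hA, ?_, rfl⟩)⟩
    simp only [lay, cR, cY, if_pos hA]
    norm_cast
    refine fcol_port (R := kAb' G pos g) (P := pW g) hA hk ?_
    intro v' hR hP
    exact (h2 v' v u v hR.1 hR.2.1 ha hp' (hP.trans hk.symm)).1
  · have hA : kBe G pos g u v := ⟨ha, hp', Or.inl hk⟩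
    refine ⟨_, Or.inr (Or.inr (Or.inl ⟨hA, ?_, rfl⟩))⟩
    simp only [lay, cR, cY, if_neg (not_ab_be hA)]
    norm_cast
    rw [fpos_comm]
    refine fcol_port hA hk ?_
    intro v' hR hP
    exact (h2 u v' u v hR.1 hR.2.1 ha hp' (hP.trans hk.symm)).2
  · have hA : kBe G pos g u v := ⟨ha, hp', Or.inr hk⟩
    refine ⟨_, Or.inr (Or.inr (Or.inr (Or.inl ⟨hA, ?_, rfl⟩)))⟩
    simp only [lay, cC, cX, if_neg (not_ab_be hA)]
    norm_cast
    rw [fpos_comm]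
    refine fcol_port (R := kBe' G pos g) (P := pS g) hA hk ?_
    intro v' hR hP
    exact (h2 v' v u v hR.1 hR.2.1 ha hp' (hP.trans hk.symm)).1

lemma poly_int (hdeg : ∀ v, (Finset.univ.filter fun z => G.Adj v z).card ≤ 7)
    (hinj : Function.Injective pos) {u v : V} {l : List Pt}
    (h : (lay (g := g) hdeg hinj).IsPoly u v l) {q : Pt} (hq : q ∈ l) :
    ∃ a b : ℤ, q = ((a : ℝ), (b : ℝ)) := by
  have hb : ∀ w, (lay (g := g) hdeg hinj).b w + 8 = ((8 * (pos w : ℤ) + 8 : ℤ) : ℝ) := by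
    intro w; simp only [lay]; push_cast; ring
  rcases h with ⟨_, _, rfl⟩ | ⟨_, _, rfl⟩ | ⟨_, _, rfl⟩ | ⟨_, _, rfl⟩ | ⟨_, rfl⟩ <;>
    simp only [List.mem_cons, List.not_mem_nil, or_false, hb] at hq
  · rcases hq with rfl | rfl | rfl | rfl <;> exact ⟨_, _, rfl⟩
  · rcases hq with rfl | rfl | rfl | rfl <;> exact ⟨_, _, rfl⟩
  · rcases hq with rfl | rfl | rfl | rfl <;> exact ⟨_, _, rfl⟩
  · rcases hq with rfl | rfl | rfl | rfl <;> exact ⟨_, _, rfl⟩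
  · rcases hq with rfl | rfl | rfl <;> exact ⟨_, _, rfl⟩

end Concrete

lemma Lay.poly_bd {V : Type} {L : Lay V} {S : ℝ} (hL : ∀ w, 0 ≤ L.b w ∧ L.b w + 8 ≤ S)
    {u v : V} {l : List Pt} (h : L.IsPoly u v l) {q : Pt} (hq : q ∈ l) :
    0 ≤ q.1 ∧ q.1 ≤ S ∧ 0 ≤ q.2 ∧ q.2 ≤ S := by
  have hXu := L.hX u
  have hXv := L.hX v
  have hYu := L.hY u
  have hYv := L.hY v
  have hu := hL u
  have hv := hL v
  rcases h with ⟨h, _, rfl⟩ | ⟨h, _, rfl⟩ | ⟨h, _, rfl⟩ | ⟨h, _, rfl⟩ | ⟨h, rfl⟩ <;>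
    simp only [List.mem_cons, List.not_mem_nil, or_false] at hq
  · have := L.ab _ _ h
    rcases hq with rfl | rfl | rfl | rfl <;> simp only [Lay.p] <;>
      refine ⟨?_, ?_, ?_, ?_⟩ <;> linarith
  · have := L.ab _ _ h
    rcases hq with rfl | rfl | rfl | rfl <;> simp only [Lay.p] <;>
      refine ⟨?_, ?_, ?_, ?_⟩ <;> linarith
  · have := L.be _ _ h
    rcases hq with rfl | rfl | rfl | rfl <;> simp only [Lay.p] <;>
      refine ⟨?_, ?_, ?_, ?_⟩ <;> linarith
  · have := L.be _ _ h
    rcases hq with rfl | rfl | rfl | rfl <;> simp only [Lay.p] <;>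
      refine ⟨?_, ?_, ?_, ?_⟩ <;> linarith
  · rcases hq with rfl | rfl | rfl <;> simp only [Lay.p] <;>
      refine ⟨?_, ?_, ?_, ?_⟩ <;> linarith

lemma main_drawing {V : Type} [Fintype V] (G : SimpleGraph V)
    (hdeg : ∀ v, (Finset.univ.filter fun z => G.Adj v z).card ≤ 7) :
    ∃ (p : V → Pt) (poly : Sym2 V → List Pt),
      IsBendRACDrawing 2 G p poly ∧
      InGridSquare (8 * (Fintype.card V : ℝ)) (drawingPoints G p poly) := by
  obtain ⟨pos, g, hinj, hlt, h1, h2⟩ := exists_ports hdeg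
  have hex : ∀ e : Sym2 V, ∃ o : V × V, ∃ l : List Pt, e ∈ G.edgeSet →
      e = s(o.1, o.2) ∧ (lay (g := g) hdeg hinj).IsPoly o.1 o.2 l := by
    intro e
    induction e with
    | _ u v =>
    by_cases he : s(u, v) ∈ G.edgeSet
    · have ha : G.Adj u v := he
      rcases lt_trichotomy (pos u) (pos v) with h | h | h
      · obtain ⟨l, hl⟩ := exists_poly hdeg hinj h1 h2 ha h
        exact ⟨(u, v), l, fun _ => ⟨rfl, hl⟩⟩
      · exact absurd (hinj h) ha.ne
      · obtain ⟨l, hl⟩ := exists_poly hdeg hinj h1 h2 ha.symm h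
        exact ⟨(v, u), l, fun _ => ⟨Sym2.eq_swap, hl⟩⟩
    · exact ⟨(u, v), [], fun h => absurd h he⟩
  choose o poly hop using hex
  refine ⟨(lay (g := g) hdeg hinj).p, poly,
    Lay.draw G o poly (fun e he => (hop e he).1) (fun e he => (hop e he).2), ?_, 0, 0, ?_⟩
  · rintro q (⟨w, rfl⟩ | ⟨e, he, hq⟩)
    · exact ⟨_, _, rfl⟩
    · exact poly_int hdeg hinj (hop e he).2 hq
  · have hb : ∀ w, 0 ≤ (lay (g := g) hdeg hinj).b w ∧
        (lay (g := g) hdeg hinj).b w + 8 ≤ 8 * (Fintype.card V : ℝ) := by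
      intro w
      have h := hlt w
      simp only [lay]
      constructor
      · positivity
      · have : ((pos w : ℝ) + 1) ≤ (Fintype.card V : ℝ) := by exact_mod_cast h
        push_cast; linarith
    simp only [zero_add]
    rintro q (⟨w, rfl⟩ | ⟨e, he, hq⟩)
    · have := hb w
      have h3 := (lay (g := g) hdeg hinj).hX w
      have h4 := (lay (g := g) hdeg hinj).hY w
      simp only [Lay.p]
      refine ⟨?_, ?_, ?_, ?_⟩ <;> linarith
    · exact Lay.poly_bd hb (hop e he).2 hq

/-- If the edge set of a graph `G` of maximum degree 7 on `n` vertices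
is partitioned into the edge set of a subgraph `H` of maximum degree 6 and a matching
`M`, then `G` admits a 2-bend RAC drawing with all vertex and bend points on integer
grid points inside a square of side `8 * n` (hence of `O(n²)` area). -/
theorem stmt2 (V : Type) [Fintype V] (G H : SimpleGraph V) (M : Set (Sym2 V))
    (hdegG : ∀ v : V, vdeg G v ≤ 7)
    (hdegH : ∀ v : V, vdeg H v ≤ 6)
    (hM : IsMatchingOn G M)
    (hdisj : Disjoint H.edgeSet M)
    (hpart : H.edgeSet ∪ M = G.edgeSet) :
    ∃ (p : V → Pt) (poly : Sym2 V → List Pt),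
      IsBendRACDrawing 2 G p poly ∧
      InGridSquare (8 * (Fintype.card V : ℝ)) (drawingPoints G p poly) := by
  apply main_drawing G
  intro v
  have h := hdegG v
  unfold vdeg at h
  rw [Set.ncard_eq_toFinset_card'] at h
  refine le_trans (Finset.card_le_card ?_) h
  intro z
  simp
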